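/- arXiv:2505.11400 — 3 statements merged into one kernel-verified Lean document; each statement's English description precedes it below -/
import Mathlib

section
/- Suppose 1/n₀ ≪ 1/t ≪ ε, d ≪ γ ≪ c, 1/k (i.e. for all c, 1/k there is γ₀, for all γ < γ₀ there are ε₀, d₀, etc.), and let q be a positive integer with q ≤ γt/3. Let H be a k-graph on n ≥ n₀ vertices with δ⁺(H) ≥ cn and with no isolated vertices, let V₀, V₁, …, V_t be the parts of an ε-regular partition of V(H), and let R be the associated (d,ε)-cluster k-graph of H on vertex set [t]. Then R contains a subgraph R* on t' ≥ (1-γ)t vertices, where t' is divisible by q, such that R* has no isolated vertices and δ⁺(R*) ≥ (c-γ)t'. -/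
open Finset

/-- The degree of a vertex set `S` in the `k`-graph with edge set `E`. -/
def degH {V : Type*} [DecidableEq V] (E : Finset (Finset V)) (S : Finset V) : ℕ :=
  (E.filter (fun e => S ⊆ e)).card

/-- The minimum positive codegree `δ⁺`: the minimum of `deg(S)` over all
`(k-1)`-element vertex sets `S` with `deg(S) ≥ 1`. -/
noncomputable def posCodeg {V : Type*} [DecidableEq V] (k : ℕ) (E : Finset (Finset V)) : ℕ :=
  sInf {d : ℕ | ∃ S : Finset V, S.card = k - 1 ∧ 1 ≤ degH E S ∧ degH E S = d}

/-- `e(V₁,…,V_k)`: the number of edges with exactly one vertex in each part `P i`. -/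
def edgeCountT {V : Type*} [DecidableEq V] (k : ℕ) (E : Finset (Finset V))
    (P : Fin k → Finset V) : ℕ :=
  (E.filter (fun e => ∀ i, (e ∩ P i).card = 1)).card

/-- The density `d(V₁,…,V_k) = e(V₁,…,V_k) / ∏ᵢ |Vᵢ|`. -/
noncomputable def densityT {V : Type*} [DecidableEq V] (k : ℕ) (E : Finset (Finset V))
    (P : Fin k → Finset V) : ℝ :=
  (edgeCountT k E P : ℝ) / ∏ i, ((P i).card : ℝ)

/-- The tuple `(P 0, …, P (k-1))` is `(d,ε)`-regular: every tuple of subsets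
`Q i ⊆ P i` with `|Q i| ≥ ε |P i|` has density within `ε` of `d`. -/
def IsRegTuple {V : Type*} [DecidableEq V] (k : ℕ) (E : Finset (Finset V))
    (P : Fin k → Finset V) (d ε : ℝ) : Prop :=
  ∀ Q : Fin k → Finset V, (∀ i, Q i ⊆ P i) →
    (∀ i, ε * ((P i).card : ℝ) ≤ ((Q i).card : ℝ)) →
    |densityT k E Q - d| ≤ ε

/-- The tuple is `ε`-regular: `(d,ε)`-regular for some `d > 0`. -/
def IsEpsReg {V : Type*} [DecidableEq V] (k : ℕ) (E : Finset (Finset V))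
    (P : Fin k → Finset V) (ε : ℝ) : Prop :=
  ∃ d : ℝ, 0 < d ∧ IsRegTuple k E P d ε

open scoped Classical in
/-- The number of `k`-element sets of clusters which do not form an `ε`-regular tuple. -/
noncomputable def badTupleCount {V : Type*} [DecidableEq V] (k t : ℕ)
    (E : Finset (Finset V)) (P : Fin t → Finset V) (ε : ℝ) : ℕ :=
  (((Finset.univ : Finset (Fin t)).powersetCard k).filter
    (fun A => ¬ ∃ f : Fin k → Fin t, Function.Injective f ∧ (∀ j, f j ∈ A) ∧
      IsEpsReg k E (fun j => P (f j)) ε)).card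

/-- `V₀, P 0, …, P (t-1)` form an `ε`-regular partition of the `k`-graph `E`:
the parts partition the vertex set, `P 0, …, P (t-1)` all have the same size,
`|V₀| ≤ ε|V|`, and all but at most `ε·C(t,k)` of the `k`-tuples of clusters are
`ε`-regular. -/
def IsRegPartition {V : Type*} [DecidableEq V] [Fintype V] (k t : ℕ)
    (E : Finset (Finset V)) (V0 : Finset V) (P : Fin t → Finset V) (ε : ℝ) : Prop :=
  (∀ i j : Fin t, i ≠ j → Disjoint (P i) (P j)) ∧
  (∀ i : Fin t, Disjoint V0 (P i)) ∧
  V0 ∪ Finset.univ.biUnion P = Finset.univ ∧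
  (∀ i j : Fin t, (P i).card = (P j).card) ∧
  (V0.card : ℝ) ≤ ε * (Fintype.card V : ℝ) ∧
  (badTupleCount k t E P ε : ℝ) ≤ ε * (t.choose k : ℝ)

open scoped Classical in
/-- The `(d,ε)`-cluster `k`-graph: vertex set `[t]`, with an edge on each `k`-set of
clusters forming an `ε`-regular tuple of density at least `d`. -/
noncomputable def clusterGraph {V : Type*} [DecidableEq V] (k t : ℕ)
    (E : Finset (Finset V)) (P : Fin t → Finset V) (d ε : ℝ) : Finset (Finset (Fin t)) :=
  ((Finset.univ : Finset (Fin t)).powersetCard k).filter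
    (fun A => ∃ f : Fin k → Fin t, Function.Injective f ∧ (∀ j, f j ∈ A) ∧
      IsEpsReg k E (fun j => P (f j)) ε ∧ d ≤ densityT k E (fun j => P (f j)))


/-- recursive badness: `BadR r A` is meant for sets `A` of size `k - r`. -/
def BadR {t : ℕ} (F : Finset (Fin t) → Prop) (s : ℝ) : ℕ → Finset (Fin t) → Prop
  | 0, A => F A
  | (r+1), A => F A ∨ s < (Set.ncard {j : Fin t | j ∉ A ∧ BadR F s r (insert j A)} : ℝ)

lemma BadR_of_F {t : ℕ} (F : Finset (Fin t) → Prop) (s : ℝ) (r : ℕ) (A : Finset (Fin t))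
    (h : F A) : BadR F s r A := by
  cases r with
  | zero => exact h
  | succ r => exact Or.inl h

open scoped Classical in
lemma double_count {t : ℕ} (p : Finset (Fin t) → Prop) (i : ℕ) :
    ∑ A ∈ powersetCard i (univ : Finset (Fin t)), #{j : Fin t | j ∉ A ∧ p (insert j A)}
      ≤ (i+1) * #{B ∈ powersetCard (i+1) (univ : Finset (Fin t)) | p B} := by
  rw [← Finset.card_sigma]
  have h2 : (i+1) * #{B ∈ powersetCard (i+1) (univ : Finset (Fin t)) | p B}
      = #(({B ∈ powersetCard (i+1) (univ : Finset (Fin t)) | p B}).sigma (fun B => B)) := by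
    rw [Finset.card_sigma, Finset.sum_congr rfl (g := fun _ => i+1)]
    · simp [mul_comm]
    · intro B hB
      simp only [mem_filter, mem_powersetCard] at hB
      exact hB.1.2
  rw [h2]
  apply Finset.card_le_card_of_injOn (fun x => ⟨insert x.2 x.1, x.2⟩)
  · rintro ⟨A, j⟩ h
    simp only [coe_sigma, Set.mem_sigma_iff, mem_coe, mem_filter, mem_powersetCard, mem_univ,
      true_and, subset_univ] at h ⊢
    refine ⟨⟨?_, h.2.2⟩, mem_insert_self _ _⟩
    rw [card_insert_of_notMem h.2.1, h.1]
  · rintro ⟨A, j⟩ h ⟨A', j'⟩ h' heq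
    simp only [coe_sigma, Set.mem_sigma_iff, mem_coe, mem_filter, mem_powersetCard, mem_univ,
      true_and, subset_univ] at h h'
    simp only [Sigma.mk.injEq, heq_eq_eq] at heq
    obtain ⟨h1, rfl⟩ := heq
    have : A = A' := by
      rw [← erase_insert h.2.1, h1, erase_insert h'.2.1]
    subst this; rfl

/-- constants in the recursion -/
noncomputable def CC (k : ℕ) (δ : ℝ) : ℕ → ℝ
  | 0 => 1
  | (r+1) => 1 + k / δ * CC k δ r

lemma CC_ge (k : ℕ) (δ : ℝ) (hδ : 0 < δ) (r : ℕ) : 1 ≤ CC k δ r := by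
  induction r with
  | zero => simp [CC]
  | succ r ih => 
    simp only [CC]
    have : 0 ≤ (k:ℝ) / δ * CC k δ r := by positivity
    linarith

open scoped Classical in
lemma badR_count {t k : ℕ} (ht : 0 < t) (F : Finset (Fin t) → Prop) (δ η : ℝ) (hδ : 0 < δ)
    (hη : 0 < η)
    (hF : ∀ i ≤ k, (#{A ∈ powersetCard i (univ : Finset (Fin t)) | F A} : ℝ) ≤ η * t ^ i)
    (r : ℕ) (hr : r ≤ k) :
    (#{A ∈ powersetCard (k - r) (univ : Finset (Fin t)) | BadR F (δ * t) r A} : ℝ)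
      ≤ CC k δ r * η * t ^ (k - r) := by
  induction r with
  | zero => simpa [CC, BadR] using hF k le_rfl
  | succ r ih =>
    have ih := ih (by omega)
    obtain ⟨i, hi⟩ : ∃ i, i = k - (r+1) := ⟨_, rfl⟩
    have hi' : k - r = i + 1 := by omega
    rw [hi'] at ih
    rw [← hi]
    have htR : (0:ℝ) < t := by exact_mod_cast ht
    have hdc := double_count (BadR F (δ * t) r) i
    set G := {A ∈ powersetCard i (univ : Finset (Fin t)) |
      δ * t < (#{j : Fin t | j ∉ A ∧ BadR F (δ * t) r (insert j A)} : ℝ)} with hG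
    have hsub : {A ∈ powersetCard i (univ : Finset (Fin t)) | BadR F (δ * t) (r+1) A} ⊆
        {A ∈ powersetCard i (univ : Finset (Fin t)) | F A} ∪ G := by
      intro A hA
      rw [mem_filter] at hA
      simp only [hG, mem_filter, mem_union]
      rw [BadR] at hA
      rcases hA with ⟨h1, h2 | h2⟩
      · exact Or.inl ⟨h1, h2⟩
      · refine Or.inr ⟨h1, ?_⟩
        rw [Set.ncard_eq_toFinset_card'] at h2
        convert h2 using 3
        ext; simp
    have hGc : δ * t * #G ≤ k * (CC k δ r * η * t ^ (i+1)) := by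
      calc δ * t * #G = ∑ A ∈ G, δ * t := by simp [mul_comm]
        _ ≤ ∑ A ∈ G, (#{j : Fin t | j ∉ A ∧ BadR F (δ * t) r (insert j A)} : ℝ) := by
            apply Finset.sum_le_sum
            intro A hA
            simp only [hG, mem_filter] at hA
            exact hA.2.le
        _ ≤ ∑ A ∈ powersetCard i (univ : Finset (Fin t)),
              (#{j : Fin t | j ∉ A ∧ BadR F (δ * t) r (insert j A)} : ℝ) := by
            apply Finset.sum_le_sum_of_subset_of_nonneg
            · exact filter_subset _ _
            · intros; positivity
        _ ≤ ((i+1 : ℕ) : ℝ) * (#{B ∈ powersetCard (i+1) (univ : Finset (Fin t)) |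
              BadR F (δ * t) r B} : ℝ) := by exact_mod_cast hdc
        _ ≤ k * (CC k δ r * η * t ^ (i+1)) := by
            gcongr
            omega
    have hGc2 : (#G : ℝ) ≤ k / δ * CC k δ r * η * t ^ i := by
      have : δ * t * #G ≤ δ * t * (k / δ * CC k δ r * η * t ^ i) := by
        calc _ ≤ _ := hGc
          _ = _ := by field_simp; ring
      exact le_of_mul_le_mul_left this (by positivity)
    have h3 := (card_le_card hsub).trans (card_union_le _ _)
    have h4 := hF i (by omega)
    have h5 : (#{A ∈ powersetCard i (univ : Finset (Fin t)) | BadR F (δ * t) (r+1) A} : ℝ) ≤ 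
      (#{A ∈ powersetCard i (univ : Finset (Fin t)) | F A} : ℝ) + #G := by exact_mod_cast h3
    simp only [CC]
    nlinarith

open scoped Classical in
lemma cleaning {t k q : ℕ} (hk : 1 ≤ k) (ht : 0 < t) (X F : Finset (Fin t) → Prop)
    (c γ δ η : ℝ) (hγ : 0 < γ) (hγc : γ < c) (hγ1 : γ < 1) (hδ : 0 < δ)
    (hδγ : (2 ^ k + 1) * δ ≤ γ / 3)
    (hη : 0 < η) (hCη : CC k δ k * η < 1) (hq : 1 ≤ q) (hqt : (q : ℝ) ≤ γ * t / 3)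
    (Rc : Finset (Finset (Fin t)))
    (hX1 : ∀ w, X {w}) (hXd : ∀ A B, A ⊆ B → X B → X A)
    (hext : ∀ A, X A → ¬ F A → #A < k →
      (c - γ / 3) * t ≤ (#{j : Fin t | j ∉ A ∧ X (insert j A)} : ℝ))
    (hR : ∀ A, X A → ¬ F A → #A = k → A ∈ Rc)
    (hF : ∀ i ≤ k, (#{A ∈ powersetCard i (univ : Finset (Fin t)) | F A} : ℝ) ≤ η * t ^ i) :
    ∃ (W : Finset (Fin t)) (R : Finset (Finset (Fin t))),
      R ⊆ Rc ∧ (∀ e ∈ R, e ⊆ W) ∧ (1 - γ) * (t : ℝ) ≤ (#W : ℝ) ∧ q ∣ #W ∧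
      (∀ w ∈ W, 1 ≤ degH R {w}) ∧ (c - γ) * (#W : ℝ) ≤ (posCodeg k R : ℝ) := by
  have htR : (0:ℝ) < t := by exact_mod_cast ht
  obtain ⟨Bad, hBad⟩ : ∃ Bad : Finset (Fin t) → Prop, Bad = fun A => BadR F (δ * t) (k - #A) A :=
    ⟨_, rfl⟩
  have hBF : ∀ A, ¬ Bad A → ¬ F A := by
    intro A h hf
    exact h (by rw [hBad]; exact BadR_of_F _ _ _ _ hf)
  have hBext : ∀ A, ¬ Bad A → #A < k → (#{j : Fin t | j ∉ A ∧ Bad (insert j A)} : ℝ) ≤ δ * t := by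
    intro A h hA
    obtain ⟨r, hr⟩ : ∃ r, k - #A = r + 1 := ⟨k - #A - 1, by omega⟩
    rw [hBad] at h
    simp only [hr, BadR, not_or, not_lt] at h
    refine le_trans (le_of_eq ?_) h.2
    rw [Set.ncard_eq_toFinset_card']
    congr 2
    ext j
    simp only [mem_filter, mem_univ, true_and, Set.mem_toFinset, Set.mem_ofPred_eq]
    constructor
    · rintro ⟨h1, h2⟩
      refine ⟨h1, ?_⟩
      rw [hBad] at h2
      simp only [card_insert_of_notMem h1] at h2
      rwa [show k - (#A + 1) = r by omega] at h2
    · rintro ⟨h1, h2⟩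
      refine ⟨h1, ?_⟩
      rw [hBad]
      simp only [card_insert_of_notMem h1]
      rwa [show k - (#A + 1) = r by omega]
  have hB0 : ¬ Bad ∅ := by
    intro h
    have h1 := badR_count ht F δ η hδ hη hF k le_rfl
    rw [Nat.sub_self, pow_zero, mul_one] at h1
    have h2 : 1 ≤ #{A ∈ powersetCard 0 (univ : Finset (Fin t)) | BadR F (δ * t) k A} := by
      apply Finset.card_pos.2
      refine ⟨∅, ?_⟩
      rw [hBad] at h
      simpa using h
    have h3 : (1:ℝ) ≤ #{A ∈ powersetCard 0 (univ : Finset (Fin t)) | BadR F (δ * t) k A} := by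
      exact_mod_cast h2
    linarith
  have hB1 := hBext ∅ hB0 (by rw [card_empty]; omega)
  simp only [notMem_empty, not_false_eq_true, true_and, insert_empty_eq] at hB1
  have hW0 : (#{j : Fin t | ¬ Bad {j}} : ℝ) = t - (#{j : Fin t | Bad {j}} : ℝ) := by
    have := Finset.card_filter_add_card_filter_not (s := (univ : Finset (Fin t))) (fun j => Bad {j})
    rw [card_univ, Fintype.card_fin] at this
    rw [eq_sub_iff_add_eq, add_comm]
    exact_mod_cast this
  obtain ⟨W, hWsub, hWcard⟩ := Finset.exists_subset_card_eq
    (s := ({j : Fin t | ¬ Bad {j}} : Finset (Fin t)))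
    (n := q * (#{j : Fin t | ¬ Bad {j}} / q)) (Nat.mul_div_le _ _)
  have hWlow : (1 - δ - γ/3) * t ≤ (#W : ℝ) := by
    have h1 : #{j : Fin t | ¬ Bad {j}} ≤ #W + q := by
      rw [hWcard]
      have := Nat.div_add_mod (#{j : Fin t | ¬ Bad {j}}) q
      have := Nat.mod_lt (#{j : Fin t | ¬ Bad {j}}) hq
      omega
    have h2 : (#{j : Fin t | ¬ Bad {j}} : ℝ) ≤ #W + q := by exact_mod_cast h1
    nlinarith
  have hWt : (#W : ℝ) ≤ t := by
    have := Finset.card_le_univ W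
    rw [Fintype.card_fin] at this
    exact_mod_cast this
  obtain ⟨Cl, hCl⟩ : ∃ Cl : Finset (Fin t) → Prop,
    Cl = fun A => X A ∧ A ⊆ W ∧ ∀ B ⊆ A, ¬ Bad B := ⟨_, rfl⟩
  have hClext : ∀ A, Cl A → #A < k →
      (c - γ) * t ≤ (#{j : Fin t | j ∉ A ∧ Cl (insert j A)} : ℝ) := by
    intro A hA hAk
    rw [hCl] at hA
    obtain ⟨hXA, hAW, hAB⟩ := hA
    have h1 := hext A hXA (hBF A (hAB A subset_rfl)) hAk
    have hsub : ({j : Fin t | j ∉ A ∧ X (insert j A)} : Finset (Fin t)) ⊆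
        ({j : Fin t | j ∉ A ∧ Cl (insert j A)} : Finset (Fin t)) ∪ (Wᶜ ∪
          A.powerset.biUnion (fun B => {j : Fin t | j ∉ B ∧ Bad (insert j B)})) := by
      intro j hj
      simp only [mem_filter, mem_univ, true_and, mem_union, mem_compl, mem_biUnion,
        mem_powerset] at hj ⊢
      by_cases hjW : j ∈ W
      swap
      · exact Or.inr (Or.inl hjW)
      by_cases hb : ∃ B ⊆ A, j ∉ B ∧ Bad (insert j B)
      · exact Or.inr (Or.inr hb)
      · left
        refine ⟨hj.1, ?_⟩
        rw [hCl]
        refine ⟨hj.2, insert_subset hjW hAW, ?_⟩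
        intro B hB hBb
        by_cases hjB : j ∈ B
        · apply hb
          refine ⟨B.erase j, ?_, notMem_erase _ _, ?_⟩
          · exact (Finset.subset_insert_iff).1 hB
          · rwa [insert_erase hjB]
        · exact hAB B ((Finset.subset_insert_iff_of_notMem hjB).1 hB) hBb
    have h2 := ((card_le_card hsub).trans (card_union_le _ _)).trans
      (Nat.add_le_add_left ((card_union_le _ _).trans
        (Nat.add_le_add_left card_biUnion_le _)) _)
    have h3 : (#{j : Fin t | j ∉ A ∧ X (insert j A)} : ℝ) ≤
      #{j : Fin t | j ∉ A ∧ Cl (insert j A)} + (#(Wᶜ) + 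
       ∑ B ∈ A.powerset, (#{j : Fin t | j ∉ B ∧ Bad (insert j B)} : ℝ)) := by exact_mod_cast h2
    have h4 : ∑ B ∈ A.powerset, (#{j : Fin t | j ∉ B ∧ Bad (insert j B)} : ℝ) ≤ 2 ^ k * (δ * t) := by
      calc _ ≤ ∑ B ∈ A.powerset, δ * t := by
            apply Finset.sum_le_sum
            intro B hB
            rw [mem_powerset] at hB
            exact hBext B (hAB B hB) ((card_le_card hB).trans_lt hAk)
        _ = 2 ^ (#A) * (δ * t) := by simp
        _ ≤ 2 ^ k * (δ * t) := by
            gcongr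
            norm_num
    have h5 : (#(Wᶜ) : ℝ) = t - #W := by
      rw [card_compl, Fintype.card_fin, Nat.cast_sub]
      exact_mod_cast hWt
    nlinarith
  have hgrow : ∀ r A, Cl A → #A + r = k → ∃ e, Cl e ∧ #e = k ∧ A ⊆ e := by
    intro r
    induction r with
    | zero => intro A hA h; exact ⟨A, hA, by simpa using h, subset_rfl⟩
    | succ r ih =>
      intro A hA h
      have h1 := hClext A hA (by omega)
      have h2 : 0 < (#{j : Fin t | j ∉ A ∧ Cl (insert j A)} : ℝ) :=
        lt_of_lt_of_le (mul_pos (by linarith) htR) h1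
      obtain ⟨j, hj⟩ := Finset.card_pos.1 (by exact_mod_cast h2)
      simp only [mem_filter, mem_univ, true_and] at hj
      obtain ⟨e, he, hek, hs⟩ := ih (insert j A) hj.2 (by rw [card_insert_of_notMem hj.1]; omega)
      exact ⟨e, he, hek, (subset_insert _ _).trans hs⟩
  set R := {e ∈ powersetCard k (univ : Finset (Fin t)) | Cl e} with hRdef
  have hRmem : ∀ e, e ∈ R ↔ #e = k ∧ Cl e := by
    intro e; simp [hRdef]
  have hvert : ∀ w ∈ W, ∃ e ∈ R, w ∈ e := by
    intro w hw
    have : Cl {w} := by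
      rw [hCl]
      refine ⟨hX1 w, by simpa using hw, ?_⟩
      intro B hB
      rcases Finset.subset_singleton_iff.1 hB with rfl | rfl
      · exact hB0
      · have := hWsub hw
        simpa using this
    obtain ⟨e, he, hek, hs⟩ := hgrow (k-1) {w} this (by simp; omega)
    exact ⟨e, (hRmem e).2 ⟨hek, he⟩, by simpa using hs⟩
  refine ⟨W, R, ?_, ?_, ?_, ?_, ?_, ?_⟩
  · intro e he
    rw [hRmem, hCl] at he
    exact hR e he.2.1 (hBF e (he.2.2.2 e subset_rfl)) he.1
  · intro e he
    rw [hRmem, hCl] at he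
    exact he.2.2.1
  · have : δ ≤ γ / 3 := by
      have : (0:ℝ) < 2 ^ k := by positivity
      nlinarith
    refine le_trans ?_ hWlow
    apply mul_le_mul_of_nonneg_right _ htR.le
    linarith
  · exact hWcard ▸ dvd_mul_right _ _
  · intro w hw
    obtain ⟨e, he, hwe⟩ := hvert w hw
    exact Finset.card_pos.2 ⟨e, by simp [he, hwe]⟩
  · have hne : {d : ℕ | ∃ S : Finset (Fin t), #S = k - 1 ∧ 1 ≤ degH R S ∧ degH R S = d}.Nonempty := by
      have hWpos : 0 < (#W : ℝ) := by
        refine lt_of_lt_of_le ?_ hWlow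
        apply mul_pos _ htR
        have : δ ≤ γ / 3 := by
          have : (0:ℝ) < 2 ^ k := by positivity
          nlinarith
        linarith
      obtain ⟨w, hw⟩ := Finset.card_pos.1 (by exact_mod_cast hWpos)
      obtain ⟨e, he, -⟩ := hvert w hw
      obtain ⟨S, hS, hSc⟩ := Finset.exists_subset_card_eq (s := e) (n := k-1)
        (by rw [((hRmem e).1 he).1]; omega)
      exact ⟨_, S, hSc, Finset.card_pos.2 ⟨e, by simp [he, hS]⟩, rfl⟩
    obtain ⟨S, hSc, hS1, hSd⟩ := Nat.sInf_mem hne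
    have : posCodeg k R = degH R S := hSd.symm
    rw [this]
    obtain ⟨e, he⟩ := Finset.card_pos.1 hS1
    simp only [mem_filter] at he
    have hClS : Cl S := by
      have := ((hRmem e).1 he.1).2
      rw [hCl] at this ⊢
      exact ⟨hXd _ _ he.2 this.1, he.2.trans this.2.1, fun B hB => this.2.2 B (hB.trans he.2)⟩
    have h1 := hClext S hClS (by omega)
    refine le_trans ?_ (h1.trans ?_)
    · have : 0 ≤ c - γ := by linarith
      gcongr
    · norm_cast
      apply Finset.card_le_card_of_injOn (fun j => insert j S)
      · intro j hj
        simp only [coe_filter, mem_univ, true_and, Set.mem_ofPred_eq] at hj ⊢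
        refine ⟨(hRmem _).2 ⟨?_, hj.2⟩, subset_insert _ _⟩
        rw [card_insert_of_notMem hj.1]; omega
      · intro j hj j' hj' h
        simp only [coe_filter, mem_univ, true_and, Set.mem_ofPred_eq] at hj hj'
        have : j ∈ insert j' S := by
          rw [← show insert j S = insert j' S from h]; exact mem_insert_self _ _
        rcases mem_insert.1 this with h | h
        · exact h
        · exact absurd h hj.1

lemma conc (β η : ℝ) (hβ : 0 < β) (hβ1 : β ≤ 1) (hη : 0 < η) :
    ∃ t1 : ℕ, ∀ t : ℕ, t1 ≤ t → ∀ (ι : Type) [Fintype ι] [DecidableEq ι] (m : ℕ)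
      (N : ι → Finset (Fin m)) (a : ℝ), 0 < t → 0 < m → Fintype.card ι ≤ t →
      (a + β) * m * t ≤ ∑ j, (#(N j) : ℝ) →
      (#{w : ι → Fin m | (#{j | w j ∈ N j} : ℝ) < a * t} : ℝ) ≤ η * m ^ (Fintype.card ι) := by
  have hlim : Filter.Tendsto (fun t : ℕ => Real.exp (-(β^2/4) * t)) Filter.atTop (nhds 0) := by
    apply Real.tendsto_exp_atBot.comp
    apply Filter.Tendsto.const_mul_atTop_of_neg
    · have : 0 < β^2 := by positivity
      linarith
    · exact tendsto_natCast_atTop_atTop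
  obtain ⟨t1, ht1⟩ := Filter.eventually_atTop.1 (hlim.eventually (gt_mem_nhds hη))
  refine ⟨t1, fun t htt ι _ _ m N a ht hm hι hN => ?_⟩
  have htη := (ht1 t htt).le
  have htR : (0:ℝ) < t := by exact_mod_cast ht
  have hmR : (0:ℝ) < m := by exact_mod_cast hm
  have hab : a + β ≤ 1 := by
    have h1 : ∑ j, (#(N j) : ℝ) ≤ ∑ j : ι, (m : ℝ) := by
      apply Finset.sum_le_sum
      intro j _
      have := Finset.card_le_univ (N j)
      rw [Fintype.card_fin] at this
      exact_mod_cast this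
    have h2 : ∑ j : ι, (m : ℝ) ≤ t * m := by
      simp only [sum_const, card_univ, nsmul_eq_mul]
      gcongr
    have h3 : (a + β) * (m * t) ≤ 1 * (m * t) := by nlinarith
    exact le_of_mul_le_mul_right h3 (by positivity)
  set l := β / 2 with hl
  set f : ι → Fin m → ℝ := fun j u => if u ∈ N j then Real.exp (-l) else 1 with hf
  have hx : Real.exp (-l) ≤ 1 - (l - l^2) := by
    have h1 : 1 + l ≤ Real.exp l := by linarith [Real.add_one_le_exp l]
    rw [Real.exp_neg]
    rw [inv_le_comm₀ (Real.exp_pos _) (by nlinarith)]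
    refine le_trans ?_ h1
    rw [inv_le_iff_one_le_mul₀ (by nlinarith)]
    have : 0 ≤ l^3 := by positivity
    nlinarith
  have hinner : ∀ j, ∑ u, f j u ≤ m * Real.exp (-(l - l^2) * (#(N j) / m)) := by
    intro j
    have h1 : ∑ u, f j u = m - (1 - Real.exp (-l)) * #(N j) := by
      have : ∀ u, f j u = 1 - (if u ∈ N j then (1 - Real.exp (-l)) else 0) := by
        intro u; simp only [hf]; split_ifs <;> ring
      simp only [this, Finset.sum_sub_distrib]
      simp
      ring
    rw [h1]
    have h2 := Real.add_one_le_exp (-(l - l^2) * (#(N j) / m))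
    have h3 : m * (-(l - l^2) * (#(N j) / m) + 1) ≤ m * Real.exp (-(l - l^2) * (#(N j) / m)) := by
      gcongr
    refine le_trans ?_ h3
    have h4 : m * (-(l - l^2) * (#(N j) / m) + 1) = m - (l - l^2) * #(N j) := by
      field_simp; ring
    rw [h4]
    have : (0:ℝ) ≤ #(N j) := by positivity
    nlinarith
  have hprod : ∑ w : ι → Fin m, ∏ j, f j (w j) ≤
      m ^ (Fintype.card ι) * Real.exp (-(l - l^2) * ((a+β) * t)) := by
    have h1 : ∑ w : ι → Fin m, ∏ j, f j (w j) = ∏ j, ∑ u, f j u := by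
      rw [Finset.prod_univ_sum, Fintype.piFinset_univ]
    rw [h1]
    calc ∏ j, ∑ u, f j u ≤ ∏ j, (m * Real.exp (-(l - l^2) * (#(N j) / m))) := by
          apply Finset.prod_le_prod
          · intro j _
            apply Finset.sum_nonneg
            intro u _
            simp only [hf]; split_ifs <;> positivity
          · intro j _; exact hinner j
      _ = m ^ (Fintype.card ι) * Real.exp (-(l - l^2) * ((∑ j, (#(N j) : ℝ)) / m)) := by
          rw [Finset.prod_mul_distrib, ← Real.exp_sum, Finset.sum_div, Finset.mul_sum]
          simp
      _ ≤ _ := by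
          apply mul_le_mul_of_nonneg_left _ (by positivity)
          apply Real.exp_le_exp.2
          have h5 : (a+β) * t ≤ (∑ j, (#(N j) : ℝ)) / m := by
            rw [le_div_iff₀ hmR]; linarith
          have h6 : 0 ≤ l - l^2 := by nlinarith
          nlinarith
  have hbad : (#{w : ι → Fin m | (#{j | w j ∈ N j} : ℝ) < a * t} : ℝ) * Real.exp (-l * (a * t)) ≤
      ∑ w : ι → Fin m, ∏ j, f j (w j) := by
    calc _ = ∑ w ∈ {w : ι → Fin m | (#{j | w j ∈ N j} : ℝ) < a * t}, Real.exp (-l * (a * t)) := by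
          simp
      _ ≤ ∑ w ∈ {w : ι → Fin m | (#{j | w j ∈ N j} : ℝ) < a * t}, ∏ j, f j (w j) := by
          apply Finset.sum_le_sum
          intro w hw
          simp only [mem_filter, mem_univ, true_and] at hw
          have : ∏ j, f j (w j) = Real.exp (-l * #{j | w j ∈ N j}) := by
            simp only [hf]
            rw [Finset.prod_ite]
            simp [← Real.exp_nat_mul]
            ring
          rw [this]
          apply Real.exp_le_exp.2
          have : 0 < l := by positivity
          nlinarith
      _ ≤ _ := by
          apply Finset.sum_le_sum_of_subset_of_nonneg (subset_univ _)
          intro w _ _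
          apply Finset.prod_nonneg
          intro j _
          simp only [hf]; split_ifs <;> positivity
  have h7 := hbad.trans hprod
  have h8 : (#{w : ι → Fin m | (#{j | w j ∈ N j} : ℝ) < a * t} : ℝ) ≤ 
      m ^ (Fintype.card ι) * Real.exp (-(β^2/4) * t) := by
    have h9 : m ^ (Fintype.card ι) * Real.exp (-(l - l^2) * ((a+β) * t)) ≤
       (m ^ (Fintype.card ι) * Real.exp (-(β^2/4) * t)) * Real.exp (-l * (a * t)) := by
      rw [mul_assoc, ← Real.exp_add]
      apply mul_le_mul_of_nonneg_left _ (by positivity)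
      apply Real.exp_le_exp.2
      have : l^2 * (a + β) * t ≤ l^2 * 1 * t := by gcongr
      have hb : β = 2 * l := by rw [hl]; ring
      rw [hb] at this ⊢
      nlinarith
    exact le_of_mul_le_mul_right (h7.trans h9) (Real.exp_pos _)
  refine h8.trans ?_
  rw [mul_comm]
  gcongr

/-- combine two partial functions -/
def comb {t m : ℕ} (A : Finset (Fin t)) (u : {j // j ∈ A} → Fin m) (w : {j // j ∉ A} → Fin m) :
    Fin t → Fin m := fun j => if h : j ∈ A then u ⟨j, h⟩ else w ⟨j, h⟩

lemma comb_count {t m : ℕ} (A : Finset (Fin t)) (Q : (Fin t → Fin m) → Prop)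
    [DecidablePred Q] :
    #{v : Fin t → Fin m | Q v} =
      ∑ u : {j // j ∈ A} → Fin m, #{w : {j // j ∉ A} → Fin m | Q (comb A u w)} := by
  rw [← Finset.card_sigma]
  symm
  apply Finset.card_bij (fun x _ => comb A x.1 x.2)
  · rintro ⟨u, w⟩ h
    simpa using h
  · rintro ⟨u, w⟩ h ⟨u', w'⟩ h' heq
    have h1 : u = u' := by
      ext j
      have := congrFun heq j.1
      simp only [comb, j.2, dite_true] at this
      exact congrArg _ this
    have h2 : w = w' := by
      ext j
      have := congrFun heq j.1
      simp only [comb, j.2, dite_false] at this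
      exact congrArg _ this
    subst h1 h2; rfl
  · intro v hv
    have : comb A (fun j => v j.1) (fun j => v j.1) = v := by
      ext j; simp [comb]
    refine ⟨⟨fun j => v j.1, fun j => v j.1⟩, ?_, this⟩
    simp only [mem_filter, mem_univ, true_and] at hv
    simp [this, hv]

lemma exists_choice {Ω : Type*} [Fintype Ω] [Nonempty Ω] (k : ℕ) (g : ℕ → Ω → ℝ) (T : ℕ → ℝ)
    (η : ℝ)
    (hg : ∀ i v, 0 ≤ g i v) (hT : ∀ i, 0 < T i)
    (h : ∀ i ≤ k, ∑ v, g i v ≤ η / (k+1) * T i * Fintype.card Ω) :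
    ∃ v, ∀ i ≤ k, g i v ≤ η * T i := by
  by_contra hcon
  push Not at hcon
  have h1 : ∀ v, η < ∑ i ∈ range (k+1), g i v / T i := by
    intro v
    obtain ⟨i, hi, hlt⟩ := hcon v
    rw [← lt_div_iff₀ (hT i)] at hlt
    refine hlt.trans_le ?_
    apply Finset.single_le_sum (f := fun i => g i v / T i)
    · intro i _; exact div_nonneg (hg i v) (hT i).le
    · simp; omega
  have h2 : ∑ v : Ω, η < ∑ v : Ω, ∑ i ∈ range (k+1), g i v / T i :=
    Finset.sum_lt_sum_of_nonempty univ_nonempty (fun v _ => h1 v)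
  rw [Finset.sum_comm] at h2
  have h3 : ∑ i ∈ range (k+1), ∑ v : Ω, g i v / T i ≤
      ∑ i ∈ range (k+1), η / (k+1) * Fintype.card Ω := by
    apply Finset.sum_le_sum
    intro i hi
    rw [← Finset.sum_div, div_le_iff₀ (hT i)]
    have := h i (by simp at hi; omega)
    linarith
  have h4 : ∑ i ∈ range (k+1), η / (k+1) * (Fintype.card Ω : ℝ) = ∑ v : Ω, η := by
    simp
    field_simp
  linarith

/-- neighbourhoods in the shadow are large -/
lemma nbr_large {n k : ℕ} (hk : 1 ≤ k) (c : ℝ) (E : Finset (Finset (Fin n)))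
    (hE : ∀ e ∈ E, #e = k) (hc : c * n ≤ (posCodeg k E : ℝ)) (S : Finset (Fin n)) (hS : #S < k)
    (e : Finset (Fin n)) (he : e ∈ E) (hSe : S ⊆ e) :
    c * n ≤ (#{x : Fin n | x ∉ S ∧ ∃ f ∈ E, insert x S ⊆ f} : ℝ) := by
  obtain ⟨S', h1, h2, h3⟩ := Finset.exists_subsuperset_card_eq hSe (n := k-1) (by omega)
    (by rw [hE e he]; omega)
  refine hc.trans ?_
  norm_cast
  have h4 : posCodeg k E ≤ degH E S' :=
    Nat.sInf_le ⟨S', h3, Finset.card_pos.2 ⟨e, by simp [he, h2]⟩, rfl⟩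
  refine h4.trans ?_
  have h5 : E.filter (fun e => S' ⊆ e) ⊆
      ({x : Fin n | x ∉ S ∧ ∃ f ∈ E, insert x S ⊆ f} : Finset (Fin n)).image
        (fun x => insert x S') := by
    intro f hf
    rw [mem_filter] at hf
    have : #(f \ S') = 1 := by
      rw [card_sdiff_of_subset hf.2, hE f hf.1, h3]; omega
    obtain ⟨x, hx⟩ := card_eq_one.1 this
    have hxm : x ∈ f \ S' := by rw [hx]; simp
    rw [mem_sdiff] at hxm
    have hins : insert x S' = f := by
      rw [insert_eq, ← hx, sdiff_union_of_subset hf.2]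
    rw [mem_image]
    refine ⟨x, ?_, hins⟩
    simp only [mem_filter, mem_univ, true_and]
    exact ⟨fun h => hxm.2 (h1 h), f, hf.1, by rw [← hins]; exact insert_subset_insert _ h1⟩
  exact (card_le_card h5).trans card_image_le

/-- the chosen vertices of the clusters in `A` -/
def img {n t m : ℕ} (φ : Fin t → Fin m → Fin n) (w : Fin t → Fin m) (A : Finset (Fin t)) :
    Finset (Fin n) := A.image (fun j => φ j (w j))

lemma img_comb {n t m : ℕ} (φ : Fin t → Fin m → Fin n) (A : Finset (Fin t))
    (u : {j // j ∈ A} → Fin m) (w : {j // j ∉ A} → Fin m) :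
    img φ (comb A u w) A = univ.image (fun j : {j // j ∈ A} => φ j.1 (u j)) := by
  ext x
  simp only [img, comb, mem_image, mem_univ, true_and, Subtype.exists]
  constructor
  · rintro ⟨j, hj, h⟩
    refine ⟨j, hj, ?_⟩
    simpa [hj] using h
  · rintro ⟨j, hj, h⟩
    refine ⟨j, hj, ?_⟩
    simpa [hj] using h

open scoped Classical in
lemma fail_small {n k t m : ℕ} (hk : 1 ≤ k) (ht : 0 < t) (hm : 0 < m)
    (c ε a β η : ℝ) (E : Finset (Finset (Fin n)))
    (hE : ∀ e ∈ E, #e = k) (hc : c * n ≤ (posCodeg k E : ℝ))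
    (φ : Fin t → Fin m → Fin n)
    (V0 : Finset (Fin n)) (hV0 : (#V0 : ℝ) ≤ ε * n)
    (hcov : ∀ x, x ∈ V0 ∨ ∃ j u, φ j u = x)
    (hεc : ε ≤ c) (hmt : m * t ≤ n) (hab : (a + β) * t + k ≤ (c - ε) * t) (hη : 0 < η)
    (hconc : ∀ (ι : Type) [Fintype ι] [DecidableEq ι] (m : ℕ)
      (N : ι → Finset (Fin m)) (a : ℝ), 0 < t → 0 < m → Fintype.card ι ≤ t →
      (a + β) * m * t ≤ ∑ j, (#(N j) : ℝ) →
      (#{w : ι → Fin m | (#{j | w j ∈ N j} : ℝ) < a * t} : ℝ) ≤ η * m ^ (Fintype.card ι))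
    (A : Finset (Fin t)) (hA : #A < k) :
    (#{w : Fin t → Fin m | (∃ e ∈ E, img φ w A ⊆ e) ∧
      (#{j : Fin t | j ∉ A ∧ ∃ e ∈ E, img φ w (insert j A) ⊆ e} : ℝ) < a * t} : ℝ) ≤ η * m ^ t := by
  have hcA : Fintype.card {j // j ∉ A} = t - #A := by
    rw [Fintype.card_subtype_compl, Fintype.card_fin, Fintype.card_coe]
  have hAt : #A ≤ t := by simpa using Finset.card_le_univ A
  rw [comb_count A]
  push_cast
  have key : ∀ u : {j // j ∈ A} → Fin m,
      (#{w : {j // j ∉ A} → Fin m | (∃ e ∈ E, img φ (comb A u w) A ⊆ e) ∧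
      (#{j : Fin t | j ∉ A ∧ ∃ e ∈ E, img φ (comb A u w) (insert j A) ⊆ e} : ℝ) < a * t} : ℝ)
        ≤ η * m ^ (t - #A) := by
    intro u
    set S := univ.image (fun j : {j // j ∈ A} => φ j.1 (u j)) with hS
    have hSc : #S < k := by
      refine lt_of_le_of_lt card_image_le ?_
      simpa using hA
    by_cases hSE : ∃ e ∈ E, S ⊆ e
    swap
    · simp only [img_comb, ← hS, hSE, false_and, filter_false, card_empty, Nat.cast_zero]
      positivity
    obtain ⟨e, he, hSe⟩ := hSE
    have hN := nbr_large hk c E hE hc S hSc e he hSe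
    set Nb := ({x : Fin n | x ∉ S ∧ ∃ f ∈ E, insert x S ⊆ f} : Finset (Fin n)) with hNb
    set N : {j // j ∉ A} → Finset (Fin m) := fun j => {v | φ j.1 v ∈ Nb} with hNdef
    have hsub : Nb ⊆ V0 ∪ (A.biUnion (fun j => univ.image (φ j)) ∪
        univ.biUnion (fun j => (N j).image (φ j.1))) := by
      intro x hx
      simp only [mem_union, mem_biUnion, mem_image, mem_univ, true_and]
      rcases hcov x with h | ⟨j, v, rfl⟩
      · exact Or.inl h
      · right
        by_cases hj : j ∈ A
        · exact Or.inl ⟨j, hj, v, rfl⟩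
        · refine Or.inr ⟨⟨j, hj⟩, v, ?_, rfl⟩
          simp only [hNdef, mem_filter, mem_univ, true_and]
          exact hx
    have h1 : #Nb ≤ #V0 + (#A * m + ∑ j, #(N j)) := by
      refine (card_le_card hsub).trans ((card_union_le _ _).trans ?_)
      gcongr
      refine (card_union_le _ _).trans ?_
      gcongr
      · refine card_biUnion_le.trans ?_
        refine (Finset.sum_le_sum (g := fun _ => m) ?_).trans ?_
        · intro j _
          refine card_image_le.trans ?_
          simp
        · simp
      · refine card_biUnion_le.trans ?_
        apply Finset.sum_le_sum
        intro j _
        exact card_image_le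
    have h1R : (#Nb : ℝ) ≤ #V0 + (#A * m + ∑ j, (#(N j) : ℝ)) := by exact_mod_cast h1
    have hmtR : (m : ℝ) * t ≤ n := by exact_mod_cast hmt
    have hAkR : (#A : ℝ) ≤ k := by exact_mod_cast hA.le
    have hmR : (0:ℝ) < m := by exact_mod_cast hm
    have hsum : (a + β) * m * t ≤ ∑ j, (#(N j) : ℝ) := by
      have h2 : (c - ε) * (m * t) ≤ (c - ε) * n := by
        apply mul_le_mul_of_nonneg_left hmtR; linarith
      have h3 : (#A : ℝ) * m ≤ k * m := by gcongr
      have h4 : ((a + β) * t + k) * m ≤ (c - ε) * t * m := by gcongr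
      nlinarith
    have h5 := hconc {j // j ∉ A} m N a ht hm (by rw [hcA]; omega) hsum
    rw [hcA] at h5
    refine le_trans ?_ h5
    norm_cast
    apply card_le_card
    intro w hw
    simp only [mem_filter, mem_univ, true_and] at hw ⊢
    refine lt_of_le_of_lt ?_ hw.2
    norm_cast
    apply Finset.card_le_card_of_injOn (fun j => j.1)
    · intro j hj
      simp only [coe_filter, mem_univ, true_and, Set.mem_ofPred_eq] at hj ⊢
      refine ⟨j.2, ?_⟩
      simp only [hNdef, hNb, mem_filter, mem_univ, true_and] at hj
      obtain ⟨-, f, hf, hfs⟩ := hj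
      refine ⟨f, hf, ?_⟩
      have : img φ (comb A u w) (insert j.1 A) = insert (φ j.1 (w j)) S := by
        rw [← img_comb φ A u w] at hS
        rw [hS, img, image_insert]
        congr 2
        simp [comb, j.2]
      rw [this]
      exact hfs
    · intro j _ j' _ h
      exact Subtype.ext h
  refine (Finset.sum_le_sum (fun u _ => key u)).trans ?_
  rw [sum_const, card_univ, Fintype.card_fun, Fintype.card_coe, Fintype.card_fin, nsmul_eq_mul]
  push_cast
  rw [mul_left_comm, ← pow_add, Nat.add_sub_cancel' hAt]

open scoped Classical in
lemma fail_dense {n k t m : ℕ} (hm : 0 < m)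
    (d : ℝ) (E : Finset (Finset (Fin n)))
    (hE : ∀ e ∈ E, #e = k) 
    (φ : Fin t → Fin m → Fin n) (hinj : ∀ j, Function.Injective (φ j))
    (P : Fin t → Finset (Fin n)) (hP : ∀ i j, i ≠ j → Disjoint (P i) (P j))
    (hφP : ∀ j u, φ j u ∈ P j) (hPm : ∀ j, #(P j) = m)
    (A : Finset (Fin t)) (hA : #A = k) (f : Fin k → Fin t) (hfA : ∀ j, f j ∈ A)
    (hd : densityT k E (fun j => P (f j)) < d) :
    (#{w : Fin t → Fin m | ∃ e ∈ E, img φ w A ⊆ e} : ℝ) ≤ d * m ^ t := by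
  have hmR : (0:ℝ) < m := by exact_mod_cast hm
  have hcA : Fintype.card {j // j ∉ A} = t - #A := by
    rw [Fintype.card_subtype_compl, Fintype.card_fin, Fintype.card_coe]
  have hAt : #A ≤ t := by simpa using Finset.card_le_univ A
  have hidx : ∀ i j u u', φ i u = φ j u' → i = j := by
    intro i j u u' h
    by_contra hij
    exact Finset.disjoint_left.1 (hP i j hij) (hφP i u) (h ▸ hφP j u')
  obtain ⟨U, hU⟩ : ∃ U : ({j // j ∈ A} → Fin m) → Finset (Fin n),
    U = fun u => univ.image (fun j : {j // j ∈ A} => φ j.1 (u j)) := ⟨_, rfl⟩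
  have hUc : ∀ u, #(U u) = k := by
    intro u
    rw [hU]
    simp only
    rw [card_image_of_injective]
    · simpa using hA
    · intro j j' h
      exact Subtype.ext (hidx _ _ _ _ h)
  have hcount : #{u | U u ∈ E} ≤ edgeCountT k E (fun j => P (f j)) := by
    apply Finset.card_le_card_of_injOn U
    · intro u hu
      simp only [coe_filter, mem_univ, true_and, Set.mem_ofPred_eq] at hu ⊢
      refine ⟨hu, fun i => ?_⟩
      rw [card_eq_one]
      refine ⟨φ (f i) (u ⟨f i, hfA i⟩), ?_⟩
      ext x
      simp only [hU, mem_inter, mem_image, mem_univ, true_and, mem_singleton]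
      constructor
      · rintro ⟨⟨j, rfl⟩, h⟩
        have : j.1 = f i := by
          by_contra hij
          exact Finset.disjoint_left.1 (hP _ _ hij) (hφP j.1 (u j)) h
        have : j = ⟨f i, hfA i⟩ := Subtype.ext this
        subst this; rfl
      · rintro rfl
        exact ⟨⟨⟨f i, hfA i⟩, rfl⟩, hφP _ _⟩
    · intro u _ u' _ h
      funext j
      have h1 : φ j.1 (u j) ∈ U u' := by
        rw [← h, hU]; exact mem_image_of_mem _ (mem_univ _)
      simp only [hU, mem_image, mem_univ, true_and] at h1
      obtain ⟨j', hj'⟩ := h1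
      have : j' = j := Subtype.ext (hidx _ _ _ _ hj')
      subst this
      exact (hinj _ hj').symm
  have hcd : (#{u | U u ∈ E} : ℝ) ≤ d * m ^ k := by
    have h1 : (#{u | U u ∈ E} : ℝ) ≤ edgeCountT k E (fun j => P (f j)) := by exact_mod_cast hcount
    refine h1.trans ?_
    rw [densityT] at hd
    simp only [hPm, prod_const, card_univ, Fintype.card_fin] at hd
    rw [div_lt_iff₀ (by positivity)] at hd
    exact hd.le
  rw [comb_count A]
  have h2 : ∀ u : {j // j ∈ A} → Fin m, #{w : {j // j ∉ A} → Fin m | ∃ e ∈ E, img φ (comb A u w) A ⊆ e}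
      ≤ if U u ∈ E then m ^ (t - k) else 0 := by
    intro u
    have h3 : (∃ e ∈ E, U u ⊆ e) ↔ U u ∈ E := by
      constructor
      · rintro ⟨e, he, hs⟩
        rwa [Finset.eq_of_subset_of_card_le hs (by rw [hUc, hE e he])]
      · intro h; exact ⟨_, h, subset_rfl⟩
    have h4 : ∀ w, img φ (comb A u w) A = U u := by
      intro w; rw [img_comb, hU]
    simp only [h4, h3]
    split_ifs with h
    · simp only [h, filter_true, card_univ, Fintype.card_fun, hcA, hA, Fintype.card_fin]
      exact le_rfl
    · simp [h]
  have h5 := Finset.sum_le_sum (s := univ) (fun u _ => h2 u)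
  rw [← Finset.sum_filter, sum_const, smul_eq_mul] at h5
  calc _ ≤ (#{u | U u ∈ E} : ℝ) * m ^ (t - k) := by exact_mod_cast h5
    _ ≤ d * m ^ k * m ^ (t - k) := by gcongr
    _ = d * m ^ t := by rw [mul_assoc, ← pow_add, Nat.add_sub_cancel' (hA ▸ hAt)]

/-- Lemma 3.3: with `1/n₀ ≪ 1/t ≪ ε, d ≪ γ ≪ c, 1/k` and `q ≤ γt/3`,
if `δ⁺(H) ≥ cn`, `H` has no isolated vertices and `V₀, V₁, …, V_t` is an `ε`-regular
partition with `(d,ε)`-cluster graph `R`, then `R` has a subgraph `R*` on `t' ≥ (1-γ)t`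
vertices, `q ∣ t'`, with no isolated vertices and `δ⁺(R*) ≥ (c-γ)t'`. -/
theorem statement13 (k : ℕ) (hk : 1 ≤ k) (c : ℝ) (hc : 0 < c) :
    ∃ γ₀ : ℝ, 0 < γ₀ ∧ ∀ γ : ℝ, 0 < γ → γ < γ₀ →
      ∃ ε₀ d₀ : ℝ, 0 < ε₀ ∧ 0 < d₀ ∧ ∀ ε d : ℝ, 0 < ε → ε < ε₀ → 0 < d → d < d₀ →
        ∃ t₀ : ℕ, ∀ t : ℕ, t₀ ≤ t →
          ∃ n₀ : ℕ, ∀ n : ℕ, n₀ ≤ n →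
            ∀ q : ℕ, 1 ≤ q → (q : ℝ) ≤ γ * t / 3 →
              ∀ E : Finset (Finset (Fin n)), (∀ e ∈ E, e.card = k) →
                c * n ≤ (posCodeg k E : ℝ) →
                (∀ v : Fin n, 1 ≤ degH E {v}) →
                ∀ (V0 : Finset (Fin n)) (P : Fin t → Finset (Fin n)),
                  IsRegPartition k t E V0 P ε →
                  ∃ (W : Finset (Fin t)) (R : Finset (Finset (Fin t))),
                    R ⊆ clusterGraph k t E P d ε ∧
                    (∀ e ∈ R, e ⊆ W) ∧
                    (1 - γ) * (t : ℝ) ≤ (W.card : ℝ) ∧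
                    q ∣ W.card ∧
                    (∀ w ∈ W, 1 ≤ degH R {w}) ∧
                    (c - γ) * (W.card : ℝ) ≤ (posCodeg k R : ℝ) := by
  classical
  refine ⟨min c 1, lt_min hc one_pos, fun γ hγ hγ0 => ?_⟩
  have hγc : γ < c := hγ0.trans_le (min_le_left _ _)
  have hγ1 : γ < 1 := hγ0.trans_le (min_le_right _ _)
  set δ : ℝ := γ / (3 * (2 ^ k + 1)) with hδdef
  have hδ : 0 < δ := by positivity
  have hδγ : (2 ^ k + 1) * δ ≤ γ / 3 := by
    rw [hδdef]; apply le_of_eq; field_simp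
  set η : ℝ := 1 / (2 * CC k δ k) with hηdef
  have hCC := CC_ge k δ hδ k
  have hη : 0 < η := by positivity
  have hCη : CC k δ k * η < 1 := by
    have : CC k δ k * η = 1 / 2 := by rw [hηdef]; field_simp
    rw [this]; norm_num
  set η1 : ℝ := η / (2 * (k + 1)) with hη1def
  have hη1 : 0 < η1 := by positivity
  have hη12 : η / (k + 1) = η1 + η1 := by rw [hη1def]; field_simp; ring
  obtain ⟨t1, ht1⟩ := conc (γ / 6) η1 (by positivity) (by linarith) hη1
  refine ⟨min (γ / 12) (min η1 (1/2)), η1, by positivity, hη1, fun ε d hε hε0 hd hd0 => ?_⟩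
  have hε1 : ε < γ / 12 := hε0.trans_le (min_le_left _ _)
  have hε2 : ε < η1 := hε0.trans_le ((min_le_right _ _).trans (min_le_left _ _))
  have hε3 : ε < 1/2 := hε0.trans_le ((min_le_right _ _).trans (min_le_right _ _))
  refine ⟨max (max t1 1) ⌈12 * k / γ⌉₊, fun t htmax => ?_⟩
  have htt1 : t1 ≤ t := ((le_max_left _ _).trans (le_max_left _ _)).trans htmax
  have ht : 0 < t := ((le_max_right _ _).trans (le_max_left _ _)).trans htmax
  have htR : (0:ℝ) < t := by exact_mod_cast ht
  have htk : (k : ℝ) ≤ γ / 12 * t := by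
    have h1 : 12 * k / γ ≤ t := (Nat.le_ceil _).trans (by exact_mod_cast (le_max_right _ _).trans htmax)
    rw [div_le_iff₀ hγ] at h1
    linarith
  refine ⟨1, fun n hn q hq hqt E hE hcE hiso V0 P hPart => ?_⟩
  obtain ⟨hPd, hV0d, hcover, hPeq, hV0, hbad⟩ := hPart
  have hnR : (0:ℝ) < n := by exact_mod_cast hn
  rw [Fintype.card_fin] at hV0
  obtain ⟨m, hmdef⟩ : ∃ m, m = #(P ⟨0, ht⟩) := ⟨_, rfl⟩
  have hPm : ∀ j, #(P j) = m := fun j => by rw [hmdef]; exact hPeq _ _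
  have hcardU : #(univ.biUnion P) = m * t := by
    rw [card_biUnion (fun i _ j _ hij => hPd i j hij)]
    simp [hPm, mul_comm]
  have hmt : m * t ≤ n := by
    rw [← hcardU]
    simpa using Finset.card_le_univ (univ.biUnion P)
  have hm : 0 < m := by
    rcases Nat.eq_zero_or_pos m with h0 | h0
    · exfalso
      have h1 : n ≤ #V0 + m * t := by
        rw [← hcardU]
        have h2 := card_union_le V0 (univ.biUnion P)
        rw [hcover] at h2
        simpa using h2
      rw [h0, zero_mul, add_zero] at h1
      have h2 : (n:ℝ) ≤ #V0 := by exact_mod_cast h1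
      nlinarith
    · exact h0
  obtain ⟨φ, hφ⟩ : ∃ φ : Fin t → Fin m → Fin n,
      φ = fun j u => (((P j).equivFinOfCardEq (hPm j)).symm u).1 := ⟨_, rfl⟩
  have hφP : ∀ j u, φ j u ∈ P j := by
    intro j u; rw [hφ]; exact Subtype.property _
  have hinj : ∀ j, Function.Injective (φ j) := by
    intro j u u' h
    rw [hφ] at h
    exact (Equiv.injective _) (Subtype.ext h)
  have hcov : ∀ x, x ∈ V0 ∨ ∃ j u, φ j u = x := by
    intro x
    have hx : x ∈ V0 ∪ univ.biUnion P := by rw [hcover]; exact mem_univ _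
    rcases mem_union.1 hx with h | h
    · exact Or.inl h
    · right
      obtain ⟨j, -, hj⟩ := mem_biUnion.1 h
      refine ⟨j, (P j).equivFinOfCardEq (hPm j) ⟨x, hj⟩, ?_⟩
      rw [hφ]; simp
  obtain ⟨Rc, hRc⟩ : ∃ Rc, Rc = clusterGraph k t E P d ε := ⟨_, rfl⟩
  obtain ⟨X, hX⟩ : ∃ X : (Fin t → Fin m) → Finset (Fin t) → Prop,
    X = fun w A => ∃ e ∈ E, img φ w A ⊆ e := ⟨_, rfl⟩
  obtain ⟨F, hF⟩ : ∃ F : (Fin t → Fin m) → Finset (Fin t) → Prop,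
    F = fun w A => X w A ∧ ((#A < k ∧
      (#{j : Fin t | j ∉ A ∧ X w (insert j A)} : ℝ) < (c - γ / 3) * t) ∨ (#A = k ∧ A ∉ Rc)) :=
    ⟨_, rfl⟩
  have hmR : (0:ℝ) < m := by exact_mod_cast hm
  -- failure probabilities
  have hfail1 : ∀ A, #A < k → (#{w | F w A} : ℝ) ≤ η1 * m ^ t := by
    intro A hA
    refine le_trans ?_ (fail_small hk ht hm c ε (c - γ/3) (γ/6) η1 E hE hcE φ V0 hV0 hcov
      (by linarith) hmt (by nlinarith) hη1 (ht1 t htt1) A hA)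
    norm_cast
    apply card_le_card
    intro w hw
    simp only [mem_filter, mem_univ, true_and, hF, hX] at hw ⊢
    rcases hw with ⟨h1, h2 | h2⟩
    · exact ⟨h1, h2.2⟩
    · omega
  have hfail2 : ∀ A, #A = k → (∃ f : Fin k → Fin t, Function.Injective f ∧ (∀ j, f j ∈ A) ∧
      IsEpsReg k E (fun j => P (f j)) ε) → (#{w | F w A} : ℝ) ≤ d * m ^ t := by
    rintro A hA ⟨f, hf1, hf2, hf3⟩
    by_cases hAR : A ∈ Rc
    · have : ∀ w, ¬ F w A := by
        intro w hw
        rw [hF] at hw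
        rcases hw with ⟨-, h | h⟩
        · omega
        · exact h.2 hAR
      simp only [this, filter_false, card_empty, Nat.cast_zero]
      positivity
    · have hdl : densityT k E (fun j => P (f j)) < d := by
        by_contra hcon
        apply hAR
        rw [hRc, clusterGraph, mem_filter]
        exact ⟨by simp [hA], f, hf1, hf2, hf3, not_lt.1 hcon⟩
      refine le_trans ?_ (fail_dense hm d E hE φ hinj P hPd hφP hPm A hA f hf2 hdl)
      norm_cast
      apply card_le_card
      intro w hw
      simp only [mem_filter, mem_univ, true_and, hF, hX] at hw ⊢
      exact hw.1
  have hfail3 : ∀ A, (#{w | F w A} : ℝ) ≤ m ^ t := by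
    intro A
    have := Finset.card_le_univ ({w | F w A} : Finset (Fin t → Fin m))
    rw [Fintype.card_fun, Fintype.card_fin, Fintype.card_fin] at this
    exact_mod_cast this
  have hchoose : ∀ i, ((t.choose i : ℕ) : ℝ) ≤ t ^ i := by
    intro i; exact_mod_cast Nat.choose_le_pow t i
  have hexp : ∀ i ≤ k, ∑ w : Fin t → Fin m,
      (#{A ∈ powersetCard i (univ : Finset (Fin t)) | F w A} : ℝ) ≤
        η / (k+1) * (t:ℝ) ^ i * Fintype.card (Fin t → Fin m) := by
    intro i hi
    have hswap : ∑ w : Fin t → Fin m, (#{A ∈ powersetCard i (univ : Finset (Fin t)) | F w A} : ℝ)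
        = ∑ A ∈ powersetCard i (univ : Finset (Fin t)), (#{w | F w A} : ℝ) := by
      simp only [card_filter]
      push_cast
      exact Finset.sum_comm
    rw [hswap, Fintype.card_fun, Fintype.card_fin, Fintype.card_fin, hη12]
    push_cast
    have hti : (0:ℝ) ≤ t ^ i := by positivity
    have hmt0 : (0:ℝ) ≤ m ^ t := by positivity
    rcases hi.lt_or_eq with hlt | rfl
    · calc _ ≤ ∑ A ∈ powersetCard i (univ : Finset (Fin t)), η1 * (m:ℝ) ^ t := by
            apply Finset.sum_le_sum
            intro A hA
            exact hfail1 A (by rw [(mem_powersetCard.1 hA).2]; exact hlt)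
        _ = (t.choose i : ℝ) * (η1 * (m:ℝ) ^ t) := by simp
        _ ≤ t ^ i * (η1 * (m:ℝ) ^ t) := by
            apply mul_le_mul_of_nonneg_right (hchoose i); positivity
        _ ≤ _ := by
            have : 0 ≤ (t:ℝ) ^ i * (η1 * (m:ℝ) ^ t) := by positivity
            nlinarith
    · set reg : Finset (Fin t) → Prop := fun A => ∃ f : Fin i → Fin t, Function.Injective f ∧
        (∀ j, f j ∈ A) ∧ IsEpsReg i E (fun j => P (f j)) ε with hreg
      have hb : (#{A ∈ powersetCard i (univ : Finset (Fin t)) | ¬ reg A} : ℝ) ≤ ε * t.choose i := by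
        refine le_trans (le_of_eq ?_) hbad
        rw [badTupleCount]
      calc _ ≤ ∑ A ∈ powersetCard i (univ : Finset (Fin t)),
              (d * (m:ℝ) ^ t + if ¬ reg A then (m:ℝ) ^ t else 0) := by
            apply Finset.sum_le_sum
            intro A hA
            by_cases hr : reg A
            · simpa [hr] using hfail2 A (mem_powersetCard.1 hA).2 hr
            · have h1 := hfail3 A
              have h2 : 0 ≤ d * (m:ℝ) ^ t := by positivity
              simp only [hr, not_false_eq_true, if_true]
              linarith
        _ = (t.choose i : ℝ) * (d * (m:ℝ) ^ t) +
              (#{A ∈ powersetCard i (univ : Finset (Fin t)) | ¬ reg A} : ℝ) * m ^ t := by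
            rw [Finset.sum_add_distrib, ← Finset.sum_filter]
            simp
        _ ≤ (t:ℝ) ^ i * (η1 * (m:ℝ) ^ t) + (η1 * t ^ i) * m ^ t := by
            apply add_le_add
            · apply mul_le_mul (hchoose i) _ (by positivity) (by positivity)
              apply mul_le_mul_of_nonneg_right hd0.le hmt0
            · apply mul_le_mul_of_nonneg_right _ hmt0
              refine hb.trans ?_
              apply mul_le_mul hε2.le (hchoose i) (by positivity) hη1.le
        _ = _ := by ring
  haveI : Nonempty (Fin t → Fin m) := ⟨fun _ => ⟨0, hm⟩⟩
  obtain ⟨w, hw⟩ := exists_choice k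
    (fun i (w : Fin t → Fin m) => (#{A ∈ powersetCard i (univ : Finset (Fin t)) | F w A} : ℝ))
    (fun i => (t:ℝ) ^ i) η (fun _ _ => by positivity) (fun _ => by positivity) hexp
  rw [← hRc]
  refine cleaning hk ht (X w) (F w) c γ δ η hγ hγc hγ1 hδ hδγ hη hCη hq hqt Rc ?_ ?_ ?_ ?_ ?_
  · intro j
    have h1 := hiso (φ j (w j))
    obtain ⟨e, he⟩ := Finset.card_pos.1 h1
    rw [mem_filter] at he
    rw [hX]
    exact ⟨e, he.1, by simpa [img] using he.2⟩
  · intro A B hAB hXB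
    rw [hX] at hXB ⊢
    obtain ⟨e, he, hs⟩ := hXB
    exact ⟨e, he, (image_subset_image hAB).trans hs⟩
  · intro A hXA hFA hA
    by_contra hcon
    apply hFA
    rw [hF]
    refine ⟨hXA, Or.inl ⟨hA, ?_⟩⟩
    have := not_le.1 hcon
    convert this
  · intro A hXA hFA hA
    by_contra hcon
    apply hFA
    rw [hF]
    exact ⟨hXA, Or.inr ⟨hA, hcon⟩⟩
  · intro i hi
    have := hw i hi
    convert this
end

section
/- Fix integers k ≥ 3 and 1 ≤ ℓ ≤ k-1 and a real d ∈ (0,1). Let H be a k-partite k-graph with vertex classes X₁, …, X_k each of size m, let P be a k-uniform ℓ-path, and let {U₁, …, U_k} be a partition of V(P) with respect to which P is k-partite. If d(X₁, …, X_k) ≥ d and |Uᵢ| ≤ dm/k for each i ∈ [k], then H contains a partition-respecting copy of P, i.e. an embedding of P into H mapping Uᵢ into Xᵢ for each i ∈ [k]. -/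
open Finset

/-- The edge set of the `k`-uniform `ℓ`-path whose vertex order is given by `vs`:
the `i`-th edge consists of the `k` consecutive vertices starting at position `i(k-ℓ)`. -/
def pathEdges {V : Type*} [DecidableEq V] (k ℓ : ℕ) (vs : List V) : Finset (Finset V) :=
  (Finset.range ((vs.length - ℓ) / (k - ℓ))).image
    (fun i => ((vs.drop (i * (k - ℓ))).take k).toFinset)

/-- `E` is (the edge set of) a `k`-uniform `ℓ`-path with vertex order `vs`. -/
def IsLPath {V : Type*} [DecidableEq V] (k ℓ : ℕ) (E : Finset (Finset V)) (vs : List V) :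
    Prop :=
  vs.Nodup ∧ (∃ m, 1 ≤ m ∧ vs.length = m * (k - ℓ) + ℓ) ∧ E = pathEdges k ℓ vs

lemma prune {V : Type*} [DecidableEq V] (k m : ℕ) (hk : 0 < k) (hm : 0 < m) (d : ℝ)
    (hd : 0 < d) (X : Fin k → Finset V) (hX : ∀ i, (X i).card = m)
    (G : Finset (Fin k → V)) (hG : ∀ g ∈ G, ∀ i, g i ∈ X i)
    (hc : d * (m : ℝ) ^ k ≤ G.card) :
    ∃ A ⊆ G, A.Nonempty ∧ ∀ g ∈ A, ∀ i,
      d * m / k ≤ (((X i).filter (fun x => Function.update g i x ∈ A)).card : ℝ) := by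
  have hne : ∀ i, ∃ x, x ∈ X i := fun i => by
    have : 0 < (X i).card := by rw [hX i]; exact hm
    exact Finset.card_pos.mp this
  choose x0 hx0 using hne
  set t : ℝ := d * m / k with ht
  have htpos : 0 < t := by positivity
  let sh : Fin k → Finset (Fin k → V) → Finset (Fin k → V) :=
    fun i A => A.image (fun g => Function.update g i (x0 i))
  let f : Finset (Fin k → V) → ℝ := fun A => (A.card : ℝ) - t * ∑ i, ((sh i A).card : ℝ)
  have hshc : ∀ i, (sh i G).card ≤ m ^ (k - 1) := by
    intro i
    have hsub : sh i G ⊆ Fintype.piFinset (Function.update X i {x0 i}) := by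
      intro h hh
      obtain ⟨g, hg, rfl⟩ := Finset.mem_image.mp hh
      rw [Fintype.mem_piFinset]
      intro j
      by_cases hj : j = i
      · subst hj; simp
      · simp [Function.update_of_ne hj, hG g hg j]
    refine (Finset.card_le_card hsub).trans ?_
    rw [Fintype.card_piFinset, ← Finset.mul_prod_erase _ _ (Finset.mem_univ i)]
    rw [Finset.prod_congr rfl (g := fun _ => m)]
    · simp
    · intro j hj
      rw [Function.update_of_ne (Finset.ne_of_mem_erase hj), hX]
  have hfG : 0 ≤ f G := by
    have h1 : ∑ i, ((sh i G).card : ℝ) ≤ k * (m : ℝ) ^ (k - 1) := by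
      calc ∑ i, ((sh i G).card : ℝ) ≤ ∑ i : Fin k, (m : ℝ) ^ (k - 1) :=
            Finset.sum_le_sum (fun i _ => by exact_mod_cast hshc i)
        _ = _ := by simp
    have h2 := mul_le_mul_of_nonneg_left h1 htpos.le
    have h3 : t * (k * (m : ℝ) ^ (k - 1)) = d * (m : ℝ) ^ k := by
      obtain ⟨n, rfl⟩ : ∃ n, k = n + 1 := ⟨k - 1, by omega⟩
      rw [ht]
      have : ((n + 1 : ℕ) : ℝ) ≠ 0 := by positivity
      field_simp
      simp [pow_succ, mul_comm]
    show 0 ≤ (G.card : ℝ) - t * ∑ i, ((sh i G).card : ℝ)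
    linarith
  have hGne : G.Nonempty := by
    rw [← Finset.card_pos]
    have : (0 : ℝ) < G.card := lt_of_lt_of_le (by positivity) hc
    exact_mod_cast this
  obtain ⟨A, hA, hmax⟩ := Finset.exists_max_image (G.powerset.filter (fun A => A.Nonempty)) f
    ⟨G, by simp [hGne]⟩
  rw [Finset.mem_filter, Finset.mem_powerset] at hA
  refine ⟨A, hA.1, hA.2, ?_⟩
  intro g hg i
  by_contra hlt
  push Not at hlt
  have hfA : 0 ≤ f A := hfG.trans (hmax G (by simp [hGne]))
  let B := A.filter (fun h => Function.update h i (x0 i) ≠ Function.update g i (x0 i))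
  have hBA : B ⊆ A := Finset.filter_subset _ _
  have hcard : A.card ≤ B.card +
      ((X i).filter (fun x => Function.update g i x ∈ A)).card := by
    rw [← Finset.card_filter_add_card_filter_not (s := A)
      (fun h => Function.update h i (x0 i) ≠ Function.update g i (x0 i))]
    refine Nat.add_le_add_left ?_ _
    apply Finset.card_le_card_of_injOn (fun h => h i)
    · intro h hh
      simp only [not_not, Finset.coe_filter, Set.mem_setOf_eq] at hh
      obtain ⟨hhA, he⟩ := hh
      have : Function.update g i (h i) = h := by
        have := congrArg (fun q => Function.update q i (h i)) he
        simpa using this.symm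
      simp only [Finset.coe_filter, Set.mem_setOf_eq]
      rw [this]
      exact ⟨hG h (hA.1 hhA) i, hhA⟩
    · intro h hh h' hh' he
      simp only [not_not, Finset.coe_filter, Set.mem_setOf_eq] at hh hh' he
      have h3 := hh.2.trans hh'.2.symm
      have := congrArg (fun q => Function.update q i (h i)) h3
      simp only [Function.update_idem, Function.update_eq_self] at this
      rw [he] at this
      simpa using this
  have hs1 : ∀ j, ((sh j B).card : ℝ) ≤ (sh j A).card := fun j => by
    exact_mod_cast Finset.card_le_card (Finset.image_subset_image hBA)
  have hs2 : ((sh i B).card : ℝ) + 1 ≤ (sh i A).card := by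
    have : (sh i B).card < (sh i A).card := by
      apply Finset.card_lt_card
      refine ⟨Finset.image_subset_image hBA, fun hs => ?_⟩
      have h1 : Function.update g i (x0 i) ∈ sh i B := hs (Finset.mem_image_of_mem _ hg)
      obtain ⟨h, hh, he⟩ := Finset.mem_image.mp h1
      exact (Finset.mem_filter.mp hh).2 he
    exact_mod_cast this
  have hs : ∑ j, ((sh j B).card : ℝ) + 1 ≤ ∑ j, ((sh j A).card : ℝ) := by
    rw [← Finset.add_sum_erase _ _ (Finset.mem_univ i),
      ← Finset.add_sum_erase (a := i) _ (fun j => ((sh j A).card : ℝ)) (Finset.mem_univ i)]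
    have := Finset.sum_le_sum (s := Finset.univ.erase i) (fun j _ => hs1 j)
    linarith
  have hfB : f A < f B := by
    have h2 := mul_le_mul_of_nonneg_left hs htpos.le
    have h3 : (A.card : ℝ) ≤ B.card +
      ((X i).filter (fun x => Function.update g i x ∈ A)).card := by exact_mod_cast hcard
    show (A.card : ℝ) - t * ∑ i, ((sh i A).card : ℝ) < (B.card : ℝ) - t * ∑ i, ((sh i B).card : ℝ)
    linarith
  by_cases hB : B.Nonempty
  · have := hmax B (by simp [hB, hBA.trans hA.1])
    linarith
  · rw [Finset.not_nonempty_iff_eq_empty] at hB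
    rw [hB] at hfB
    have : f ∅ = 0 := by simp [f, sh]
    linarith

lemma embed {V W : Type*} [DecidableEq V] [DecidableEq W] (k : ℕ) (t : ℝ)
    (X : Fin k → Finset V) (hXdisj : ∀ i j, i ≠ j → Disjoint (X i) (X j))
    (E : Finset (Finset V)) (A : Finset (Fin k → V)) (hne : A.Nonempty)
    (hAE : ∀ g ∈ A, Finset.univ.image g ∈ E)
    (hdeg : ∀ g ∈ A, ∀ i,
      t ≤ (((X i).filter (fun x => Function.update g i x ∈ A)).card : ℝ))
    (v0 : V) (c : W → Fin k) (l : List W) (hl : l.Nodup)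
    (hcount : ∀ i, ((l.toFinset.filter (fun w => c w = i)).card : ℝ) ≤ t) :
    ∃ φ : W → V, ∃ g ∈ A, (∀ w ∈ l, ∀ w' ∈ l, φ w = φ w' → w = w') ∧
      (∀ w ∈ l, φ w ∈ X (c w)) ∧
      (∀ s, s <:+ l → (s.map c).Nodup → ∀ w ∈ s, g (c w) = φ w) ∧
      (∀ s, s <:+: l → (s.map c).Nodup → s.length = k → s.toFinset.image φ ∈ E) := by
  have hfull : ∀ (s : List W) (φ : W → V) (g : Fin k → V), g ∈ A → (s.map c).Nodup →
      s.length = k → (∀ w ∈ s, g (c w) = φ w) → s.toFinset.image φ ∈ E := by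
    intro s φ g hg hs hlen h
    have h1 : (s.map c).toFinset = Finset.univ := by
      apply Finset.eq_univ_of_card
      rw [List.toFinset_card_of_nodup hs]; simp [hlen]
    have h2 : s.toFinset.image φ = Finset.univ.image g := by
      rw [← h1]
      ext x
      simp only [Finset.mem_image, List.mem_toFinset, List.mem_map]
      constructor
      · rintro ⟨w, hw, rfl⟩; exact ⟨c w, ⟨w, hw, rfl⟩, h w hw⟩
      · rintro ⟨_, ⟨w, hw, rfl⟩, rfl⟩; exact ⟨w, hw, (h w hw).symm⟩
    rw [h2]; exact hAE g hg
  induction l using List.reverseRecOn with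
  | nil =>
    obtain ⟨g, hg⟩ := hne
    refine ⟨fun _ => v0, g, hg, by simp, by simp, ?_, ?_⟩
    · intro s hs _ w hw
      rw [List.suffix_nil.mp hs] at hw; simp at hw
    · intro s hs hn hlen
      have hs' := List.infix_nil.mp hs
      apply hfull s _ g hg hn hlen
      intro w hw; rw [hs'] at hw; simp at hw
  | append_singleton l w ih =>
    have hl' : l.Nodup ∧ w ∉ l := by
      rw [List.nodup_append] at hl
      refine ⟨hl.1, fun hw => hl.2.2 w hw w (by simp) rfl⟩
    obtain ⟨hln, hwl⟩ := hl'
    obtain ⟨φ, g, hg, hinj, hφX, hsuf, hinf⟩ := ih hln (fun i => by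
      refine le_trans ?_ (hcount i)
      norm_cast
      apply Finset.card_le_card
      apply Finset.filter_subset_filter
      intro x; simp; tauto)
    have hlt : (((l.toFinset.filter (fun w' => c w' = c w)).image φ).card : ℝ) <
        (((X (c w)).filter (fun x => Function.update g (c w) x ∈ A)).card : ℝ) := by
      refine lt_of_lt_of_le ?_ ((hcount (c w)).trans (hdeg g hg (c w)))
      norm_cast
      refine lt_of_le_of_lt Finset.card_image_le (Finset.card_lt_card ?_)
      rw [Finset.ssubset_iff_of_subset]
      · exact ⟨w, by simp, by simp [hwl]⟩
      · apply Finset.filter_subset_filter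
        intro x; simp; tauto
    obtain ⟨x, hx, hxn⟩ := Finset.exists_mem_notMem_of_card_lt_card (by exact_mod_cast hlt)
    rw [Finset.mem_filter] at hx
    have hnew : ∀ w' ∈ l, φ w' ≠ x := by
      intro w' hw' he
      by_cases hc : c w' = c w
      · apply hxn
        rw [Finset.mem_image]
        exact ⟨w', by simp [hw', hc], he⟩
      · exact Finset.disjoint_left.mp (hXdisj _ _ hc) (hφX w' hw') (he ▸ hx.1)
    have hφ' : ∀ w' ∈ l, Function.update φ w x w' = φ w' := fun w' hw' =>
      Function.update_of_ne (fun h : w' = w => hwl (h ▸ hw')) _ _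
    have hsuf' : ∀ s, s <:+ l ++ [w] → (s.map c).Nodup → ∀ w' ∈ s,
        Function.update g (c w) x (c w') = Function.update φ w x w' := by
      intro s hs hn w' hw'
      rcases List.suffix_concat_iff.mp hs with rfl | ⟨s', rfl, hs'⟩
      · simp at hw'
      · rw [List.map_append, List.nodup_append] at hn
        rcases List.mem_append.mp hw' with h | h
        · rw [hφ' w' (hs'.subset h), Function.update_of_ne]
          · exact hsuf s' hs' hn.1 w' h
          · exact hn.2.2 _ (List.mem_map_of_mem h) _ (by simp)
        · rw [List.mem_singleton] at h
          subst h; simp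
    refine ⟨Function.update φ w x, Function.update g (c w) x, hx.2, ?_, ?_, hsuf', ?_⟩
    · intro a ha b hb hab
      rw [List.mem_append, List.mem_singleton] at ha hb
      rcases ha with ha | rfl <;> rcases hb with hb | rfl
      · rw [hφ' a ha, hφ' b hb] at hab; exact hinj a ha b hb hab
      · rw [hφ' a ha, Function.update_self] at hab; exact absurd hab (hnew a ha)
      · rw [hφ' b hb, Function.update_self] at hab; exact absurd hab.symm (hnew b hb)
      · rfl
    · intro a ha
      rw [List.mem_append, List.mem_singleton] at ha
      rcases ha with ha | rfl
      · rw [hφ' a ha]; exact hφX a ha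
      · rw [Function.update_self]; exact hx.1
    · intro s hs hn hlen
      rcases List.infix_concat_iff.mp hs with h | h
      · exact hfull s _ _ hx.2 hn hlen (hsuf' s h hn)
      · have : s.toFinset.image (Function.update φ w x) = s.toFinset.image φ := by
          apply Finset.image_congr
          intro a ha
          exact hφ' a (h.subset (by simpa using ha))
        rw [this]; exact hinf s h hn hlen

/-- Lemma 3.4: if `H` is `k`-partite with classes `X₁,…,X_k` of size
`m` and `d(X₁,…,X_k) ≥ d`, and `P` is a `k`-partite `k`-uniform `ℓ`-path with classes
`U₁,…,U_k` of sizes `|Uᵢ| ≤ dm/k`, then `H` contains a partition-respecting copy of `P`. -/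
theorem statement14 {V W : Type*} [DecidableEq V] [Fintype V] [DecidableEq W]
    (k ℓ : ℕ) (hk : 3 ≤ k) (hℓ1 : 1 ≤ ℓ) (hℓ2 : ℓ ≤ k - 1)
    (d : ℝ) (hd0 : 0 < d) (hd1 : d < 1) (m : ℕ)
    (E : Finset (Finset V)) (hE : ∀ e ∈ E, e.card = k)
    (X : Fin k → Finset V)
    (hXdisj : ∀ i j, i ≠ j → Disjoint (X i) (X j))
    (hXcover : Finset.univ.biUnion X = Finset.univ)
    (hXpart : ∀ e ∈ E, ∀ i, (e ∩ X i).card ≤ 1)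
    (hXcard : ∀ i, (X i).card = m)
    (F : Finset (Finset W)) (ps : List W) (hP : IsLPath k ℓ F ps)
    (U : Fin k → Finset W)
    (hUdisj : ∀ i j, i ≠ j → Disjoint (U i) (U j))
    (hUcover : Finset.univ.biUnion U = ps.toFinset)
    (hUpart : ∀ e ∈ F, ∀ i, (e ∩ U i).card ≤ 1)
    (hdens : d ≤ densityT k E X)
    (hUcard : ∀ i, ((U i).card : ℝ) ≤ d * (m : ℝ) / (k : ℝ)) :
    ∃ φ : W → V, Set.InjOn φ (ps.toFinset : Set W) ∧
      (∀ i, ∀ w ∈ U i, φ w ∈ X i) ∧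
      (∀ e ∈ F, e.image φ ∈ E) := by
  classical
  have hkpos : 0 < k := by omega
  have hm : 0 < m := by
    rcases Nat.eq_zero_or_pos m with h | h
    · subst h
      exfalso
      have : densityT k E X = 0 := by
        unfold densityT
        simp [hXcard, hkpos.ne']
      linarith
    · exact h
  let G := (Fintype.piFinset X).filter (fun g => Finset.univ.image g ∈ E)
  have hGcard : edgeCountT k E X ≤ G.card := by
    unfold edgeCountT
    refine le_trans (Finset.card_le_card (t := G.image (fun g => Finset.univ.image g)) ?_)
      Finset.card_image_le
    intro e he
    rw [Finset.mem_filter] at he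
    obtain ⟨heE, he1⟩ := he
    have hx : ∀ i, ∃ x, x ∈ e ∩ X i := fun i => by
      apply Finset.card_pos.mp; rw [he1 i]; exact one_pos
    choose g hg using hx
    have hge : Finset.univ.image g = e := by
      apply Finset.eq_of_subset_of_card_le
      · intro y hy
        obtain ⟨i, _, rfl⟩ := Finset.mem_image.mp hy
        exact (Finset.mem_inter.mp (hg i)).1
      · rw [hE e heE, Finset.card_image_of_injective]
        · simp
        · intro i j hij
          by_contra hne
          exact Finset.disjoint_left.mp (hXdisj i j hne) (Finset.mem_inter.mp (hg i)).2
            (hij ▸ (Finset.mem_inter.mp (hg j)).2)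
    rw [Finset.mem_image]
    refine ⟨g, ?_, hge⟩
    rw [Finset.mem_filter, Fintype.mem_piFinset]
    exact ⟨fun i => (Finset.mem_inter.mp (hg i)).2, by rw [hge]; exact heE⟩
  have hc : d * (m : ℝ) ^ k ≤ G.card := by
    unfold densityT at hdens
    simp only [hXcard, Finset.prod_const, Finset.card_univ, Fintype.card_fin] at hdens
    rw [le_div_iff₀ (by positivity)] at hdens
    exact hdens.trans (by exact_mod_cast hGcard)
  obtain ⟨A, hAG, hAne, hdeg⟩ := prune k m hkpos hm d hd0 X hXcard G
    (fun g hg => Fintype.mem_piFinset.mp (Finset.mem_filter.mp hg).1) hc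
  obtain ⟨g0, hg0⟩ := id hAne
  obtain ⟨hnd, ⟨M, hM1, hlen⟩, hF⟩ := hP
  have hcol : ∀ w, ∃ i, w ∈ ps → w ∈ U i := by
    intro w
    by_cases hw : w ∈ ps
    · have : w ∈ Finset.univ.biUnion U := by rw [hUcover]; simpa using hw
      obtain ⟨i, _, hi⟩ := Finset.mem_biUnion.mp this
      exact ⟨i, fun _ => hi⟩
    · exact ⟨⟨0, hkpos⟩, fun h => absurd h hw⟩
  choose c hcU using hcol
  have hUps : ∀ i, ∀ w ∈ U i, w ∈ ps ∧ c w = i := by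
    intro i w hw
    have h1 : w ∈ ps := by
      rw [← List.mem_toFinset, ← hUcover]
      exact Finset.mem_biUnion.mpr ⟨i, Finset.mem_univ _, hw⟩
    refine ⟨h1, ?_⟩
    by_contra hne
    exact Finset.disjoint_left.mp (hUdisj _ _ hne) (hcU w h1) hw
  obtain ⟨φ, g, hg, hinj, hφX, -, hinf⟩ := embed k (d * m / k) X hXdisj E A hAne
    (fun g hg => (Finset.mem_filter.mp (hAG hg)).2) hdeg (g0 ⟨0, hkpos⟩) c ps hnd
    (fun i => by
      refine le_trans ?_ (hUcard i)
      norm_cast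
      apply Finset.card_le_card
      intro w hw
      simp only [Finset.mem_filter, List.mem_toFinset] at hw
      exact hw.2 ▸ hcU w hw.1)
  refine ⟨φ, ?_, ?_, ?_⟩
  · intro a ha b hb hab
    exact hinj a (by simpa using ha) b (by simpa using hb) hab
  · intro i w hw
    obtain ⟨h1, h2⟩ := hUps i w hw
    exact h2 ▸ hφX w h1
  · intro e he
    have he' := he
    rw [hF, pathEdges, Finset.mem_image] at he'
    obtain ⟨j, hj, hje⟩ := he'
    rw [Finset.mem_range, hlen, Nat.add_sub_cancel, Nat.mul_div_cancel _ (by omega)] at hj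
    have hsubl : (ps.drop (j * (k - ℓ))).take k <:+: ps :=
      (List.IsPrefix.isInfix ⟨_, List.take_append_drop k _⟩).trans (List.drop_suffix _ _).isInfix
    rw [← hje]
    apply hinf _ hsubl
    · apply List.Nodup.map_on
      · intro a ha b hb hab
        have h1 := hUpart e he (c a)
        rw [Finset.card_le_one] at h1
        apply h1
        · rw [Finset.mem_inter, ← hje, List.mem_toFinset]
          exact ⟨ha, hcU a (hsubl.subset ha)⟩
        · rw [Finset.mem_inter, ← hje, List.mem_toFinset]
          exact ⟨hb, hab ▸ hcU b (hsubl.subset hb)⟩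
      · exact hnd.sublist hsubl.sublist
    · rw [List.length_take, List.length_drop, hlen]
      have h1 : (j + 1) * (k - ℓ) ≤ M * (k - ℓ) := Nat.mul_le_mul_right _ hj
      rw [Nat.add_mul, Nat.one_mul] at h1
      omega
end

section
/- Fix integers k ≥ 3 and 1 ≤ ℓ ≤ k-1 and a real α > 0 (sufficiently small in terms of k), and set t = (2k-1)(k-ℓ) + ℓ. There exists n₀ such that the following holds for every k-graph H on n ≥ n₀ vertices with δ⁺(H) ≥ (1 - 1/⌈k/(k-ℓ)⌉)·n + αn and no isolated vertices: for every set T of k-ℓ vertices of H, the number of ordered t-tuples of distinct vertices of V(H)∖T which absorb T is at least α^t · n^t. -/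
open Finset

/-- The tuple of distinct vertices `vs` (disjoint from `T`) absorbs the `(k-ℓ)`-set `T`:
(i) `vs`, in that order, forms an `ℓ`-path `Q` in `E`, and (ii) there is an `ℓ`-path in
`E` with vertex set `{v ∈ vs} ∪ T` and the same ends as `Q`. -/
def AbsorbsTuple {V : Type*} [DecidableEq V] (k ℓ : ℕ) (E : Finset (Finset V)) (vs : List V)
    (T : Finset V) : Prop :=
  vs.Nodup ∧ Disjoint vs.toFinset T ∧ pathEdges k ℓ vs ⊆ E ∧
  ∃ ws : List V, ws.Nodup ∧ ws.toFinset = vs.toFinset ∪ T ∧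
    (∃ m, 1 ≤ m ∧ ws.length = m * (k - ℓ) + ℓ) ∧ pathEdges k ℓ ws ⊆ E ∧
    ws.take ℓ = vs.take ℓ ∧ ws.drop (ws.length - ℓ) = vs.drop (vs.length - ℓ)

namespace Absorb

/-- Every infix of length at most `k` is positive. -/
def Tight {V : Type*} [DecidableEq V] (k : ℕ) (Pos : Finset V → Prop) (L : List V) : Prop :=
  ∀ I : List V, I <:+: L → I.length ≤ k → Pos I.toFinset

theorem card_snoc {V : Type*} [Fintype V] (P P' : List V → Prop) [DecidablePred P]
    [DecidablePred P'] (c m : ℕ)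
    (h : ∀ L : List V, L.length = m → P L →
      c ≤ (Finset.univ.filter (fun v => P' (L ++ [v]))).card) :
    c * (Finset.univ.filter (fun g : Fin m → V => P (List.ofFn g))).card ≤
      (Finset.univ.filter (fun g : Fin (m + 1) → V => P' (List.ofFn g))).card := by
  classical
  rw [mul_comm]
  have : ((Finset.univ.filter (fun g : Fin m → V => P (List.ofFn g))).sigma
      (fun g => Finset.univ.filter (fun v => P' (List.ofFn g ++ [v])))).card ≤
      (Finset.univ.filter (fun g : Fin (m + 1) → V => P' (List.ofFn g))).card := by
    apply Finset.card_le_card_of_injOn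
      (fun p => (Fin.snoc p.1 p.2 : Fin (m + 1) → V))
    · rintro ⟨g, v⟩ hp
      simp only [Finset.coe_sigma, Set.mem_sigma_iff, Finset.mem_coe, Finset.mem_filter,
        Finset.mem_univ, true_and] at hp ⊢
      rw [List.ofFn_succ']
      simpa using hp.2
    · rintro ⟨g, v⟩ - ⟨g', v'⟩ - h
      have h' : (Fin.snoc g v : Fin (m + 1) → V) = Fin.snoc g' v' := h
      have h1 : g = g' := by
        have := congrArg (fun q : Fin (m + 1) → V => (Fin.init q : Fin m → V)) h'
        simpa using this
      have h2 : v = v' := by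
        have := congrFun h' (Fin.last m)
        simpa using this
      subst h1 h2
      rfl
  refine le_trans ?_ this
  rw [Finset.card_sigma]
  refine Finset.card_nsmul_le_sum _ _ c ?_
  intro g hg
  exact h _ (by simp) (by simpa using hg)

theorem card_cons {V : Type*} [Fintype V] (P P' : List V → Prop) [DecidablePred P]
    [DecidablePred P'] (c m : ℕ)
    (h : ∀ L : List V, L.length = m → P L →
      c ≤ (Finset.univ.filter (fun v => P' (v :: L))).card) :
    c * (Finset.univ.filter (fun g : Fin m → V => P (List.ofFn g))).card ≤
      (Finset.univ.filter (fun g : Fin (m + 1) → V => P' (List.ofFn g))).card := by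
  classical
  rw [mul_comm]
  have : ((Finset.univ.filter (fun g : Fin m → V => P (List.ofFn g))).sigma
      (fun g => Finset.univ.filter (fun v => P' (v :: List.ofFn g)))).card ≤
      (Finset.univ.filter (fun g : Fin (m + 1) → V => P' (List.ofFn g))).card := by
    apply Finset.card_le_card_of_injOn
      (fun p => (Fin.cons p.2 p.1 : Fin (m + 1) → V))
    · rintro ⟨g, v⟩ hp
      simp only [Finset.coe_sigma, Set.mem_sigma_iff, Finset.mem_coe, Finset.mem_filter,
        Finset.mem_univ, true_and] at hp ⊢
      rw [List.ofFn_succ]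
      simpa using hp.2
    · rintro ⟨g, v⟩ - ⟨g', v'⟩ - h
      have h' : (Fin.cons v g : Fin (m + 1) → V) = Fin.cons v' g' := h
      obtain ⟨h2, h1⟩ := Fin.cons_injective2 h'
      subst h1 h2
      rfl
  refine le_trans ?_ this
  rw [Finset.card_sigma]
  refine Finset.card_nsmul_le_sum _ _ c ?_
  intro g hg
  exact h _ (by simp) (by simpa using hg)

section
variable {V : Type*} [DecidableEq V] {k : ℕ} {Pos : Finset V → Prop}

theorem Tight.snoc (mono : ∀ A B : Finset V, A ⊆ B → Pos B → Pos A)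
    {L : List V} {v : V} (hL : Tight k Pos L)
    (hv : Pos (insert v (L.rtake (k - 1)).toFinset)) : Tight k Pos (L ++ [v]) := by
  intro I hI hk
  rw [List.infix_concat_iff] at hI
  rcases hI with hI | hI
  · rw [List.suffix_concat_iff] at hI
    rcases hI with rfl | ⟨t, rfl, ht⟩
    · exact mono _ _ (by simp) hv
    · refine mono _ _ ?_ hv
      have hlen : t.length ≤ k - 1 := by simp at hk; omega
      have hsub : t <:+ L.rtake (k - 1) := by
        unfold List.rtake
        refine List.suffix_of_suffix_length_le ht (List.drop_suffix _ _) ?_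
        have := ht.length_le
        simp; omega
      intro a ha
      have := hsub.subset
      simp at ha ⊢
      tauto
  · exact hL I hI hk

theorem Tight.cons (mono : ∀ A B : Finset V, A ⊆ B → Pos B → Pos A)
    {L : List V} {v : V} (hL : Tight k Pos L)
    (hv : Pos (insert v (L.take (k - 1)).toFinset)) : Tight k Pos (v :: L) := by
  intro I hI hk
  rw [List.infix_cons_iff] at hI
  rcases hI with hI | hI
  · rw [List.prefix_cons_iff] at hI
    rcases hI with rfl | ⟨t, rfl, ht⟩
    · exact mono _ _ (by simp) hv
    · refine mono _ _ ?_ hv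
      have hlen : t.length ≤ k - 1 := by simp at hk; omega
      have hsub : t <+: L.take (k - 1) := by
        refine List.prefix_of_prefix_length_le ht (List.take_prefix _ _) ?_
        have := ht.length_le
        simp; omega
      intro a ha
      have := hsub.subset
      simp at ha ⊢
      tauto
  · exact hL I hI hk

theorem Tight.rtake {L : List V} (hL : Tight k Pos L) (m : ℕ) (hm : m ≤ k) :
    Pos (L.rtake m).toFinset := by
  apply hL
  · exact (List.drop_suffix _ _).isInfix
  · unfold List.rtake; simp; omega

theorem Tight.take {L : List V} (hL : Tight k Pos L) (m : ℕ) (hm : m ≤ k) :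
    Pos (L.take m).toFinset := by
  apply hL
  · exact (List.take_prefix _ _).isInfix
  · simp; omega

theorem rtake_card (L : List V) (m : ℕ) : (L.rtake m).toFinset.card ≤ m := by
  refine (List.toFinset_card_le _).trans ?_
  unfold List.rtake; simp; omega

theorem take_card (L : List V) (m : ℕ) : (L.take m).toFinset.card ≤ m := by
  refine (List.toFinset_card_le _).trans ?_
  simp

theorem two_nbhd [Fintype V] [DecidablePred Pos] {D c M : ℕ}
    (hD : ∀ S : Finset V, S.card < k → Pos S →
      D ≤ (Finset.univ.filter (fun v => Pos (insert v S))).card)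
    (hc : Fintype.card V + c + M ≤ 2 * D) (S₁ S₂ F : Finset V)
    (h₁ : S₁.card < k) (p₁ : Pos S₁) (h₂ : S₂.card < k) (p₂ : Pos S₂) (hF : F.card ≤ M) :
    c ≤ (Finset.univ.filter
      (fun v => v ∉ F ∧ Pos (insert v S₁) ∧ Pos (insert v S₂))).card := by
  have a₁ := hD S₁ h₁ p₁
  have a₂ := hD S₂ h₂ p₂
  set A := Finset.univ.filter (fun v => Pos (insert v S₁))
  set B := Finset.univ.filter (fun v => Pos (insert v S₂))
  have h3 : (Finset.univ.filter
      (fun v => v ∉ F ∧ Pos (insert v S₁) ∧ Pos (insert v S₂))) = (A ∩ B) \ F := by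
    ext v; simp [A, B]; tauto
  rw [h3]
  have h4 := Finset.card_union_add_card_inter A B
  have h5 : (A ∪ B).card ≤ Fintype.card V := Finset.card_le_univ _
  have h6 := Finset.le_card_sdiff F (A ∩ B)
  omega

/-- The invariants of the construction. -/
def Core (k : ℕ) (Pos : Finset V → Prop) (X : List V) (L W : List V) (j : ℕ) : Prop :=
  Tight k Pos L ∧ Tight k Pos W ∧ W.Perm (L ++ X.take j) ∧ (L ++ X).Nodup

def PA (k : ℕ) (Pos : Finset V → Prop) (X : List V) (j s : ℕ) (L : List V) : Prop :=
  ∃ W, Core k Pos X L W j ∧ L.length = (2 * k - 1) * j + s ∧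
    L.rtake (k - 1) = W.rtake (k - 1) ∧ ∀ x, X[j]? = some x →
      Pos (insert x (L.rtake s).toFinset)

def PB (k : ℕ) (Pos : Finset V → Prop) (X : List V) (j i : ℕ) (L : List V) : Prop :=
  ∃ W, Core k Pos X L W (j + 1) ∧ L.length = (2 * k - 1) * j + k + i ∧
    L.rtake i = W.rtake i

def PC (k : ℕ) (Pos : Finset V → Prop) (X : List V) (d i : ℕ) (L : List V) : Prop :=
  ∃ W, Core k Pos X L W d ∧ L.length = (2 * k - 1) * d + i ∧
    L.rtake (k - 1) = W.rtake (k - 1) ∧ L.take i = W.take i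

theorem rtake_snoc (L : List V) (v : V) (m : ℕ) :
    (L ++ [v]).rtake (m + 1) = L.rtake m ++ [v] := by
  exact List.rtake_concat_succ _ _ _

theorem rtake_snoc_congr {L W : List V} (v : V) {m : ℕ} (h : L.rtake m = W.rtake m) :
    (L ++ [v]).rtake m = (W ++ [v]).rtake m := by
  cases m with
  | zero => simp
  | succ m =>
    rw [rtake_snoc, rtake_snoc]
    have : ∀ Z : List V, Z.rtake m = (Z.rtake (m + 1)).rtake m := by
      intro Z; simp [List.rtake_eq_reverse_take_reverse, List.take_take]
    rw [this L, this W, h]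

theorem rtake_cons {L : List V} (v : V) {m : ℕ} (h : m ≤ L.length) :
    (v :: L).rtake m = L.rtake m := by
  unfold List.rtake
  rw [List.length_cons, show L.length + 1 - m = (L.length - m) + 1 by omega, List.drop_succ_cons]

theorem card_append (L X : List V) : (L ++ X).toFinset.card ≤ L.length + X.length := by
  refine (List.toFinset_card_le _).trans ?_
  simp

variable [Fintype V] [DecidablePred Pos] {D c M : ℕ} {X : List V}

theorem stepA [∀ j s, DecidablePred (PA k Pos X j s)]
    (mono : ∀ A B : Finset V, A ⊆ B → Pos B → Pos A)
    (hD : ∀ S : Finset V, S.card < k → Pos S →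
      D ≤ (Finset.univ.filter (fun v => Pos (insert v S))).card)
    (hc : Fintype.card V + c + M ≤ 2 * D) (j s : ℕ) (hs : s < k - 1) (hj : j < X.length)
    (L : List V) (hM : L.length + X.length ≤ M) (hL : PA k Pos X j s L) :
    c ≤ (Finset.univ.filter (fun v => PA k Pos X j (s + 1) (L ++ [v]))).card := by
  obtain ⟨W, ⟨tL, tW, hp, hn⟩, hlen, hr, hx⟩ := hL
  have hx' := hx X[j] (by simp [hj])
  have e1 : (insert X[j] (L.rtake s).toFinset).card < k := by
    have := Finset.card_insert_le X[j] (L.rtake s).toFinset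
    have := rtake_card L s
    omega
  refine (two_nbhd hD hc (L.rtake (k - 1)).toFinset (insert X[j] (L.rtake s).toFinset)
    (L ++ X).toFinset (by have := rtake_card L (k - 1); omega) (tL.rtake _ (by omega)) e1 hx'
    ((card_append L X).trans hM)).trans (Finset.card_le_card ?_)
  intro v
  simp only [Finset.mem_filter, Finset.mem_univ, true_and, List.mem_toFinset]
  rintro ⟨hv, h1, h2⟩
  refine ⟨W ++ [v], ⟨tL.snoc mono h1, tW.snoc mono (hr ▸ h1), ?_, ?_⟩, ?_, ?_, ?_⟩
  · refine (hp.append_right [v]).trans ?_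
    simp only [List.append_assoc]
    exact (List.perm_append_comm).append_left L
  · have : (L ++ [v] ++ X).Perm (v :: (L ++ X)) := by
      simp only [List.append_assoc, List.singleton_append]
      exact List.perm_middle
    exact this.nodup_iff.2 (List.nodup_cons.2 ⟨hv, hn⟩)
  · simp; omega
  · exact rtake_snoc_congr v hr
  · intro x hxx
    have : x = X[j] := by simp [hj] at hxx; exact hxx.symm
    subst this
    rw [rtake_snoc]
    refine mono _ _ ?_ h2
    intro a; simp; tauto

theorem stepAB [∀ j s, DecidablePred (PB k Pos X j s)]
    (mono : ∀ A B : Finset V, A ⊆ B → Pos B → Pos A) (hk : 1 ≤ k)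
    (hD : ∀ S : Finset V, S.card < k → Pos S →
      D ≤ (Finset.univ.filter (fun v => Pos (insert v S))).card)
    (hc : Fintype.card V + c + M ≤ 2 * D) (j : ℕ) (hj : j < X.length)
    (L : List V) (hM : L.length + X.length ≤ M) (hL : PA k Pos X j (k - 1) L) :
    c ≤ (Finset.univ.filter (fun v => PB k Pos X j 0 (L ++ [v]))).card := by
  obtain ⟨W, ⟨tL, tW, hp, hn⟩, hlen, hr, hx⟩ := hL
  have hx' := hx X[j] (by simp [hj])
  refine (two_nbhd hD hc (L.rtake (k - 1)).toFinset (W.take (k - 1)).toFinset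
    (L ++ X).toFinset (by have := rtake_card L (k - 1); omega) (tL.rtake _ (by omega))
    (by have := take_card W (k - 1); omega) (tW.take _ (by omega))
    ((card_append L X).trans hM)).trans (Finset.card_le_card ?_)
  intro v
  simp only [Finset.mem_filter, Finset.mem_univ, true_and, List.mem_toFinset]
  rintro ⟨hv, h1, h2⟩
  have hWl : k - 1 ≤ W.length := by
    rw [hp.length_eq]; simp; omega
  refine ⟨v :: (W ++ [X[j]]), ⟨tL.snoc mono h1, ?_, ?_, ?_⟩, ?_, ?_⟩
  · refine (tW.snoc mono (hr ▸ hx')).cons mono ?_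
    rwa [List.take_append_of_le_length hWl]
  · have e : X.take (j + 1) = X.take j ++ [X[j]] := by simp
    rw [e]
    have h3 : (L ++ [v] ++ (X.take j ++ [X[j]])).Perm (v :: (L ++ (X.take j ++ [X[j]]))) := by
      simp only [List.append_assoc, List.singleton_append]
      exact List.perm_middle
    refine List.Perm.trans ?_ h3.symm
    refine List.Perm.cons v ?_
    rw [← List.append_assoc]
    exact hp.append_right _
  · have : (L ++ [v] ++ X).Perm (v :: (L ++ X)) := by
      simp only [List.append_assoc, List.singleton_append]
      exact List.perm_middle
    exact this.nodup_iff.2 (List.nodup_cons.2 ⟨hv, hn⟩)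
  · simp; omega
  · simp

theorem stepB [∀ j s, DecidablePred (PB k Pos X j s)]
    (mono : ∀ A B : Finset V, A ⊆ B → Pos B → Pos A) (hk : 1 ≤ k)
    (hD : ∀ S : Finset V, S.card < k → Pos S →
      D ≤ (Finset.univ.filter (fun v => Pos (insert v S))).card)
    (hc : Fintype.card V + c + M ≤ 2 * D) (j i : ℕ)
    (L : List V) (hM : L.length + X.length ≤ M) (hL : PB k Pos X j i L) :
    c ≤ (Finset.univ.filter (fun v => PB k Pos X j (i + 1) (L ++ [v]))).card := by
  obtain ⟨W, ⟨tL, tW, hp, hn⟩, hlen, hr⟩ := hL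
  refine (two_nbhd hD hc (L.rtake (k - 1)).toFinset (W.rtake (k - 1)).toFinset
    (L ++ X).toFinset (by have := rtake_card L (k - 1); omega) (tL.rtake _ (by omega))
    (by have := rtake_card W (k - 1); omega) (tW.rtake _ (by omega))
    ((card_append L X).trans hM)).trans (Finset.card_le_card ?_)
  intro v
  simp only [Finset.mem_filter, Finset.mem_univ, true_and, List.mem_toFinset]
  rintro ⟨hv, h1, h2⟩
  refine ⟨W ++ [v], ⟨tL.snoc mono h1, tW.snoc mono h2, ?_, ?_⟩, ?_, ?_⟩
  · refine (hp.append_right [v]).trans ?_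
    simp only [List.append_assoc]
    exact (List.perm_append_comm).append_left L
  · have : (L ++ [v] ++ X).Perm (v :: (L ++ X)) := by
      simp only [List.append_assoc, List.singleton_append]
      exact List.perm_middle
    exact this.nodup_iff.2 (List.nodup_cons.2 ⟨hv, hn⟩)
  · simp; omega
  · rw [rtake_snoc, rtake_snoc, hr]

theorem stepC {d : ℕ} (hd : 1 ≤ d) [∀ i, DecidablePred (PC k Pos X d i)]
    (mono : ∀ A B : Finset V, A ⊆ B → Pos B → Pos A) (hk : 1 ≤ k)
    (hD : ∀ S : Finset V, S.card < k → Pos S →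
      D ≤ (Finset.univ.filter (fun v => Pos (insert v S))).card)
    (hc : Fintype.card V + c + M ≤ 2 * D) (i : ℕ)
    (L : List V) (hM : L.length + X.length ≤ M) (hL : PC k Pos X d i L) :
    c ≤ (Finset.univ.filter (fun v => PC k Pos X d (i + 1) (v :: L))).card := by
  obtain ⟨W, ⟨tL, tW, hp, hn⟩, hlen, hr, ht⟩ := hL
  refine (two_nbhd hD hc (L.take (k - 1)).toFinset (W.take (k - 1)).toFinset
    (L ++ X).toFinset (by have := take_card L (k - 1); omega) (tL.take _ (by omega))
    (by have := take_card W (k - 1); omega) (tW.take _ (by omega))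
    ((card_append L X).trans hM)).trans (Finset.card_le_card ?_)
  intro v
  simp only [Finset.mem_filter, Finset.mem_univ, true_and, List.mem_toFinset]
  rintro ⟨hv, h1, h2⟩
  have hLl : k - 1 ≤ L.length := by
    have : (2 * k - 1) * 1 ≤ (2 * k - 1) * d := Nat.mul_le_mul_left _ hd
    omega
  have hWl : k - 1 ≤ W.length := by
    rw [hp.length_eq]; simp; omega
  refine ⟨v :: W, ⟨tL.cons mono h1, tW.cons mono h2, ?_, ?_⟩, ?_, ?_, ?_⟩
  · exact hp.cons v
  · exact List.nodup_cons.2 ⟨hv, hn⟩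
  · simp; omega
  · rw [rtake_cons v hLl, rtake_cons v hWl, hr]
  · simp [ht]

open scoped Classical in
theorem count (mono : ∀ A B : Finset V, A ⊆ B → Pos B → Pos A) (hk : 1 ≤ k)
    (hD : ∀ S : Finset V, S.card < k → Pos S →
      D ≤ (Finset.univ.filter (fun v => Pos (insert v S))).card)
    (hX : X.Nodup) (hX1 : 1 ≤ X.length) (hpos : ∀ x, Pos {x}) (ℓ : ℕ)
    (hM : (2 * k - 1) * X.length + ℓ + X.length ≤ M)
    (hc : Fintype.card V + c + M ≤ 2 * D) :
    c ^ ((2 * k - 1) * X.length + ℓ) ≤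
      (Finset.univ.filter (fun g : Fin ((2 * k - 1) * X.length + ℓ) → V =>
        PC k Pos X X.length ℓ (List.ofFn g))).card := by
  have hblk : ∀ j < X.length, (2 * k - 1) * j + (2 * k - 1) ≤ (2 * k - 1) * X.length := by
    intro j hj
    have := Nat.mul_le_mul_left (2 * k - 1) (show j + 1 ≤ X.length from hj)
    rwa [Nat.mul_add, Nat.mul_one] at this
  have hA : ∀ j < X.length,
      c ^ ((2 * k - 1) * j) ≤ (Finset.univ.filter (fun g : Fin ((2 * k - 1) * j) → V =>
        PA k Pos X j 0 (List.ofFn g))).card →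
      ∀ s ≤ k - 1, c ^ ((2 * k - 1) * j + s) ≤
        (Finset.univ.filter (fun g : Fin ((2 * k - 1) * j + s) → V =>
        PA k Pos X j s (List.ofFn g))).card := by
    intro j hj h0 s
    induction s with
    | zero => intro _; exact h0
    | succ s ih =>
      intro hs
      have hb := hblk j hj
      refine le_trans ?_ (card_snoc (PA k Pos X j s) (PA k Pos X j (s + 1)) c
        ((2 * k - 1) * j + s) ?_)
      · rw [← Nat.add_assoc, pow_succ, mul_comm]
        exact Nat.mul_le_mul_left _ (ih (by omega))
      · intro L hl hP
        exact stepA mono hD hc j s (by omega) hj L (by omega) hP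
  have hB : ∀ j < X.length,
      c ^ ((2 * k - 1) * j) ≤ (Finset.univ.filter (fun g : Fin ((2 * k - 1) * j) → V =>
        PA k Pos X j 0 (List.ofFn g))).card →
      ∀ i ≤ k - 1, c ^ ((2 * k - 1) * j + (k - 1) + 1 + i) ≤
        (Finset.univ.filter (fun g : Fin ((2 * k - 1) * j + (k - 1) + 1 + i) → V =>
        PB k Pos X j i (List.ofFn g))).card := by
    intro j hj h0 i
    have hb := hblk j hj
    induction i with
    | zero =>
      intro _
      refine le_trans ?_ (card_snoc (PA k Pos X j (k - 1)) (PB k Pos X j 0) c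
        ((2 * k - 1) * j + (k - 1)) ?_)
      · rw [Nat.add_zero, pow_succ, mul_comm]
        exact Nat.mul_le_mul_left _ (hA j hj h0 _ le_rfl)
      · intro L hl hP
        exact stepAB mono hk hD hc j hj L (by omega) hP
    | succ i ih =>
      intro hs
      refine le_trans ?_ (card_snoc (PB k Pos X j i) (PB k Pos X j (i + 1)) c
        ((2 * k - 1) * j + (k - 1) + 1 + i) ?_)
      · rw [← Nat.add_assoc, pow_succ, mul_comm]
        exact Nat.mul_le_mul_left _ (ih (by omega))
      · intro L hl hP
        exact stepB mono hk hD hc j i L (by omega) hP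
  have hB' : ∀ j < X.length,
      c ^ ((2 * k - 1) * j) ≤ (Finset.univ.filter (fun g : Fin ((2 * k - 1) * j) → V =>
        PA k Pos X j 0 (List.ofFn g))).card →
      c ^ ((2 * k - 1) * (j + 1)) ≤
        (Finset.univ.filter (fun g : Fin ((2 * k - 1) * (j + 1)) → V =>
        PB k Pos X j (k - 1) (List.ofFn g))).card := by
    intro j hj h0
    have e : (2 * k - 1) * (j + 1) = (2 * k - 1) * j + (k - 1) + 1 + (k - 1) := by
      rw [Nat.mul_add, Nat.mul_one]; omega
    rw [e]
    exact hB j hj h0 _ le_rfl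
  have hstart : ∀ j < X.length,
      c ^ ((2 * k - 1) * j) ≤ (Finset.univ.filter (fun g : Fin ((2 * k - 1) * j) → V =>
        PA k Pos X j 0 (List.ofFn g))).card := by
    intro j
    induction j with
    | zero =>
      intro _
      have hP : PA k Pos X 0 0 ([] : List V) := by
        have t0 : Tight k Pos ([] : List V) := by
          intro I hI _
          have : I = [] := by simpa using hI
          subst this
          obtain ⟨x, hx⟩ := List.exists_mem_of_length_pos (l := X) (by omega)
          exact mono _ _ (by simp) (hpos x)
        refine ⟨[], ⟨t0, t0, by simp, by simpa using hX⟩, by simp, rfl, ?_⟩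
        intro x _
        simpa using hpos x
      rw [Nat.mul_zero, pow_zero]
      refine Finset.card_pos.2 ⟨fun i => i.elim0, Finset.mem_filter.2 ⟨Finset.mem_univ _, ?_⟩⟩
      simpa using hP
    | succ j ih =>
      intro hj
      refine (hB' j (by omega) (ih (by omega))).trans (Finset.card_le_card ?_)
      intro g
      simp only [Finset.mem_filter, Finset.mem_univ, true_and]
      rintro ⟨W, hC, hl, hr⟩
      refine ⟨W, hC, by simp, hr, ?_⟩
      intro x _
      simpa using hpos x
  induction ℓ with
  | zero =>
    obtain ⟨j, hj⟩ : ∃ j, X.length = j + 1 := ⟨X.length - 1, by omega⟩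
    rw [Nat.add_zero]
    have := hB' j (by omega) (hstart j (by omega))
    rw [← hj] at this
    refine this.trans (Finset.card_le_card ?_)
    intro g
    simp only [Finset.mem_filter, Finset.mem_univ, true_and]
    rintro ⟨W, hC, hl, hr⟩
    rw [← hj] at hC
    exact ⟨W, hC, by simp, hr, by simp⟩
  | succ i ih =>
    refine le_trans ?_ (card_cons (PC k Pos X X.length i) (PC k Pos X X.length (i + 1)) c
        ((2 * k - 1) * X.length + i) ?_)
    · rw [← Nat.add_assoc, pow_succ, mul_comm]
      exact Nat.mul_le_mul_left _ (ih (by omega))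
    · intro L hl hP
      exact stepC hX1 mono hk hD hc i L (by omega) hP

end

theorem path_sub {V : Type*} [DecidableEq V] {k ℓ : ℕ} (hℓ : ℓ < k) {E : Finset (Finset V)}
    (hE : ∀ e ∈ E, e.card = k) {L : List V} (hn : L.Nodup)
    (hT : Tight k (fun S => ∃ e ∈ E, S ⊆ e) L) : pathEdges k ℓ L ⊆ E := by
  intro s hs
  unfold pathEdges at hs
  simp only [Finset.mem_image, Finset.mem_range] at hs
  obtain ⟨i, hi, rfl⟩ := hs
  have h1 : (i + 1) * (k - ℓ) ≤ L.length - ℓ := by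
    have := Nat.mul_le_mul_right (k - ℓ) (show i + 1 ≤ (L.length - ℓ) / (k - ℓ) from hi)
    exact this.trans (Nat.div_mul_le_self _ _)
  rw [Nat.add_mul, Nat.one_mul] at h1
  have hinf : (L.drop (i * (k - ℓ))).take k <:+: L :=
    ((List.take_prefix _ _).isInfix).trans (List.drop_suffix _ _).isInfix
  have hlen : ((L.drop (i * (k - ℓ))).take k).length = k := by
    simp; omega
  obtain ⟨e, he, hsub⟩ := hT _ hinf hlen.le
  have hcard : ((L.drop (i * (k - ℓ))).take k).toFinset.card = k := by
    rw [List.toFinset_card_of_nodup (hinf.sublist.nodup hn), hlen]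
  rw [Finset.eq_of_subset_of_card_le hsub (by rw [hcard, hE e he])]
  exact he

theorem absorbs {V : Type*} [DecidableEq V] {k ℓ : ℕ} (hℓ : ℓ < k) {E : Finset (Finset V)}
    (hE : ∀ e ∈ E, e.card = k) (T : Finset V) (hT : T.card = k - ℓ) {L : List V}
    (h : PC k (fun S => ∃ e ∈ E, S ⊆ e) T.toList (k - ℓ) ℓ L) : AbsorbsTuple k ℓ E L T := by
  obtain ⟨W, ⟨tL, tW, hp, hn⟩, hlen, hr, ht⟩ := h
  rw [List.take_of_length_le (by simp [hT])] at hp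
  have hnW : W.Nodup := hp.nodup_iff.2 hn
  have hnL : L.Nodup := (List.nodup_append.1 hn).1
  have hWlen : W.length = L.length + (k - ℓ) := by rw [hp.length_eq]; simp [hT]
  refine ⟨hnL, ?_, path_sub hℓ hE hnL tL, W, hnW, ?_, ⟨2 * k, by omega, ?_⟩,
    path_sub hℓ hE hnW tW, ht.symm, ?_⟩
  · rw [Finset.disjoint_left]
    intro a ha haT
    exact (List.nodup_append.1 hn).2.2 a (by simpa using ha) a (by simpa using haT) rfl
  · rw [List.toFinset_eq_of_perm _ _ hp]; simp
  · rw [hWlen, hlen]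
    obtain ⟨m, hm⟩ : ∃ m, 2 * k = m + 1 := ⟨2 * k - 1, by omega⟩
    rw [hm, Nat.add_mul]; simp; omega
  · have key : ∀ Z : List V, Z.rtake ℓ = (Z.rtake (k - 1)).rtake ℓ := by
      intro Z
      simp only [List.rtake_eq_reverse_take_reverse, List.reverse_reverse, List.take_take]
      rw [Nat.min_eq_left (by omega)]
    change W.rtake ℓ = L.rtake ℓ
    rw [key, key L, hr]

open scoped Classical in
theorem codeg {n k : ℕ} (hk : 1 ≤ k) {E : Finset (Finset (Fin n))} (hE : ∀ e ∈ E, e.card = k)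
    (S : Finset (Fin n)) (hS : S.card < k) (hpos : ∃ e ∈ E, S ⊆ e) :
    posCodeg k E ≤ (Finset.univ.filter (fun v => ∃ e ∈ E, insert v S ⊆ e)).card := by
  obtain ⟨e, he, hSe⟩ := hpos
  obtain ⟨S', h1, h2, h3⟩ := Finset.exists_subsuperset_card_eq hSe
    (show S.card ≤ k - 1 by omega) (by rw [hE e he]; omega)
  have hd : 1 ≤ degH E S' := Finset.card_pos.2 ⟨e, by simp [he, h2]⟩
  have h4 : posCodeg k E ≤ degH E S' := Nat.sInf_le ⟨S', h3, hd, rfl⟩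
  refine h4.trans ?_
  refine le_trans (Finset.card_le_card ?_) (Finset.card_image_le (f := fun v => insert v S'))
  intro f hf
  simp only [Finset.mem_filter, Finset.mem_image, Finset.mem_univ, true_and] at hf ⊢
  obtain ⟨hfE, hf⟩ := hf
  have h5 : (f \ S').card = 1 := by
    rw [Finset.card_sdiff_of_subset hf, hE f hfE, h3]; omega
  obtain ⟨v, hv⟩ := Finset.card_eq_one.1 h5
  have h6 : insert v S' = f := by
    rw [Finset.insert_eq, ← hv]; exact Finset.sdiff_union_of_subset hf
  refine ⟨v, ⟨f, hfE, ?_⟩, h6⟩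
  rw [← h6]
  exact Finset.insert_subset_insert _ h1

end Absorb

open scoped Classical in
/-- Claim 2.4: with `t = (2k-1)(k-ℓ)+ℓ`, for sufficiently small `α > 0`
and large `n`, if `δ⁺(H) ≥ (1 - 1/⌈k/(k-ℓ)⌉)n + αn` and `H` has no isolated vertices,
then every `(k-ℓ)`-set `T` of vertices is absorbed by at least `αᵗnᵗ` ordered `t`-tuples
of distinct vertices of `V(H) ∖ T`. -/
theorem statement18 (k ℓ : ℕ) (hk : 3 ≤ k) (hℓ1 : 1 ≤ ℓ) (hℓ2 : ℓ ≤ k - 1) :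
    ∃ α₀ : ℝ, 0 < α₀ ∧ ∀ α : ℝ, 0 < α → α < α₀ →
      ∃ n₀ : ℕ, ∀ n : ℕ, n₀ ≤ n →
        ∀ E : Finset (Finset (Fin n)), (∀ e ∈ E, e.card = k) →
          (1 - 1 / (((k + (k - ℓ) - 1) / (k - ℓ) : ℕ) : ℝ)) * n + α * n ≤ (posCodeg k E : ℝ) →
          (∀ v : Fin n, 1 ≤ degH E {v}) →
          ∀ T : Finset (Fin n), T.card = k - ℓ →
            α ^ ((2 * k - 1) * (k - ℓ) + ℓ) * (n : ℝ) ^ ((2 * k - 1) * (k - ℓ) + ℓ) ≤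
              ((((Finset.univ : Finset (Fin ((2 * k - 1) * (k - ℓ) + ℓ) → Fin n))).filter
                  (fun g => AbsorbsTuple k ℓ E (List.ofFn g) T)).card : ℝ) := by
  refine ⟨1, one_pos, fun α hα _ => ?_⟩
  set t := (2 * k - 1) * (k - ℓ) + ℓ with ht
  obtain ⟨n₀, hn₀⟩ := exists_nat_ge (((t + (k - ℓ) + 1 : ℕ) : ℝ) / α)
  refine ⟨n₀, fun n hn E hE hdeg hiso T hT => ?_⟩
  have hn' : ((t + (k - ℓ) + 1 : ℕ) : ℝ) ≤ α * n := by
    rw [div_le_iff₀ hα] at hn₀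
    have : (n₀ : ℝ) ≤ n := by exact_mod_cast hn
    nlinarith
  have hr : 2 ≤ (k + (k - ℓ) - 1) / (k - ℓ) := by
    rw [Nat.le_div_iff_mul_le (by omega)]; omega
  have hD2 : (n : ℝ) + 2 * (α * n) ≤ 2 * (posCodeg k E : ℝ) := by
    have hr' : (2 : ℝ) ≤ (((k + (k - ℓ) - 1) / (k - ℓ) : ℕ) : ℝ) := by exact_mod_cast hr
    have h1 : 1 / (((k + (k - ℓ) - 1) / (k - ℓ) : ℕ) : ℝ) ≤ 1 / 2 :=
      one_div_le_one_div_of_le (by norm_num) hr'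
    have h2 : (0 : ℝ) ≤ n := Nat.cast_nonneg n
    nlinarith
  have hc : Fintype.card (Fin n) + ⌈α * n⌉₊ + (t + (k - ℓ)) ≤ 2 * posCodeg k E := by
    have h1 : (⌈α * n⌉₊ : ℝ) < α * n + 1 := Nat.ceil_lt_add_one (by positivity)
    rw [Fintype.card_fin]
    have : ((n + ⌈α * n⌉₊ + (t + (k - ℓ)) : ℕ) : ℝ) ≤ ((2 * posCodeg k E : ℕ) : ℝ) := by
      push_cast at hn' ⊢
      linarith
    exact_mod_cast this
  have hpos : ∀ x : Fin n, ∃ e ∈ E, ({x} : Finset (Fin n)) ⊆ e := by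
    intro x
    obtain ⟨e, he⟩ := Finset.card_pos.1 (hiso x)
    rw [Finset.mem_filter] at he
    exact ⟨e, he⟩
  have hlen : T.toList.length = k - ℓ := by simp [hT]
  have hcount := Absorb.count (k := k) (Pos := fun S : Finset (Fin n) => ∃ e ∈ E, S ⊆ e)
    (X := T.toList) (D := posCodeg k E) (c := ⌈α * n⌉₊) (M := t + (k - ℓ))
    (fun A B hAB ⟨e, he, h⟩ => ⟨e, he, hAB.trans h⟩) (by omega)
    (fun S hS hP => Absorb.codeg (by omega) hE S hS hP) (Finset.nodup_toList T)
    (by omega) hpos ℓ (by rw [hlen]) hc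
  rw [hlen] at hcount
  have h1 : ⌈α * n⌉₊ ^ t ≤ ((Finset.univ : Finset (Fin t → Fin n)).filter
      (fun g => AbsorbsTuple k ℓ E (List.ofFn g) T)).card := by
    refine hcount.trans (Finset.card_le_card ?_)
    intro g
    simp only [Finset.mem_filter, Finset.mem_univ, true_and]
    exact fun h => Absorb.absorbs (by omega) hE T hT h
  rw [← mul_pow]
  calc (α * n) ^ t ≤ (⌈α * n⌉₊ : ℝ) ^ t :=
        pow_le_pow_left₀ (by positivity) (Nat.le_ceil _) t
    _ ≤ _ := by exact_mod_cast h1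
end
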